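/- Let B ⊂ ℝ^d be a closed Euclidean ball with boundary sphere S = ∂B, let m ≤ M₀ be positive integers, and let π_1,…,π_{M₀} be real-analytic on an open set U ⊇ B. Fix K ≥ 1 and suppose N ∈ ℕ is such that every nontrivial d-tree on M₀ indices in 𝒢_{K+1} satisfies the strong multiplicity N condition on B and the strong multiplicity N condition on S. Then there exists a finite constant C, depending only on N, K, M₀, and d, such that for every nontrivial d-tree G on m indices with G ∈ 𝒢_K, all ε_1,…,ε_{m−1} > 0, every λ ∈ ℝ with λ ≠ 0, and every c > 0 with |∂^Gπ(x)| ≥ c for all x in D_ε := {x ∈ B : |π_j(x)| ≤ ε_j for j = 1,…,m−1, and π_j(x) ≥ 0 for j = m+1,…,M₀}, one has |∫_{D_ε} e^{iλπ_m(x)} dx| ≤ C · c^{−1/#G} · |λ|^{−G^{(m)}/#G} · Π_{j=1}^{m−1} ε_j^{G^{(j)}/#G}. -/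

import Mathlib

open MeasureTheory
open scoped ENNReal

/-- A `d`-tree on `m` indices: an element of `⋃ K, 𝒢_K` where `𝒢_0 = {1,…,m}` and
`𝒢_K = 𝒢_{K-1} ∪ (𝒢_{K-1})^d`. -/
inductive DTree (d m : ℕ) : Type
  | leaf : Fin m → DTree d m
  | node : (Fin d → DTree d m) → DTree d m

namespace DTree
variable {d m : ℕ}

/-- `#G`: `0` for a trivial tree, `#G_1 + ⋯ + #G_d + 1` for `G = (G_1,…,G_d)`. -/
noncomputable def count : DTree d m → ℕ :=
  DTree.rec (motive := fun _ => ℕ) (fun _ => 0) (fun _ ih => (∑ k, ih k) + 1)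

/-- `G^{(j)}`: the number of leaves of `G` carrying the index `j`. -/
noncomputable def mult (j : Fin m) : DTree d m → ℕ :=
  DTree.rec (motive := fun _ => ℕ) (fun i => if i = j then 1 else 0) (fun _ ih => ∑ k, ih k)

/-- The depth of a `d`-tree; `G ∈ 𝒢_K` if and only if `G.depth ≤ K`. -/
noncomputable def depth : DTree d m → ℕ :=
  DTree.rec (motive := fun _ => ℕ) (fun _ => 0) (fun _ ih => (Finset.univ.sup ih) + 1)

/-- The derived function `∂^G π`: `π_i` for the trivial tree `i`, and the Jacobian
determinant `det [∂_{x_r} (∂^{G_k} π)]` for `G = (G_1,…,G_d)`. -/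
noncomputable def deriv (π : Fin m → (Fin d → ℝ) → ℝ) : DTree d m → (Fin d → ℝ) → ℝ :=
  DTree.rec (motive := fun _ => (Fin d → ℝ) → ℝ) (fun i => π i)
    (fun _ ih x => (Matrix.of fun r k : Fin d => fderiv ℝ (ih k) x (Pi.single r 1)).det)

/-- A `d`-tree is nontrivial when it is not a single leaf. -/
def Nontrivial (G : DTree d m) : Prop := ∀ i, G ≠ DTree.leaf i

end DTree

/-- The strong multiplicity `N` condition on `M` for a `d`-tree `G`: trivial trees satisfy
it, and `G = (G_1,…,G_d)` satisfies it when each `G_k` does and moreover for every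
`c ∈ ℝ^d` the system `∂^{G_k}π(x) = c_k` has at most `N` nondegenerate solutions `x ∈ M`
(nondegenerate meaning `∂^Gπ(x) ≠ 0`). -/
noncomputable def DTree.StrongMult {d m : ℕ} (M : Set (Fin d → ℝ))
    (π : Fin m → (Fin d → ℝ) → ℝ) (N : ℕ) : DTree d m → Prop :=
  DTree.rec (motive := fun _ => Prop) (fun _ => True)
    (fun Gs ih => (∀ k, ih k) ∧ ∀ c : Fin d → ℝ,
      ({x ∈ M | (∀ k, (Gs k).deriv π x = c k) ∧
          (DTree.node Gs).deriv π x ≠ 0}.encard : ℕ∞) ≤ N)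

/-- The strong multiplicity `N` condition on the sphere `S = ∂B` (center `x₀`) for a
`d`-tree `G`: trivial trees satisfy it, and `G = (G_1,…,G_d)` satisfies it when each `G_k`
does and for every choice of `d-1` components `σ` and every `c ∈ ℝ^{d-1}` the system
`∂^{G_{σ_k}}π(x) = c_k` has at most `N` nondegenerate solutions `x ∈ S`, nondegeneracy
meaning that the gradients of the `∂^{G_{σ_k}}π` together with the outward normal `x - x₀`
are linearly independent. -/
noncomputable def DTree.StrongMultSphere {d m : ℕ} (x₀ : Fin d → ℝ)
    (S : Set (Fin d → ℝ)) (π : Fin m → (Fin d → ℝ) → ℝ) (N : ℕ) : DTree d m → Prop :=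
  DTree.rec (motive := fun _ => Prop) (fun _ => True)
    (fun Gs ih => (∀ k, ih k) ∧
      ∀ σ : Fin (d - 1) → Fin d, ∀ c : Fin (d - 1) → ℝ,
        ({x ∈ S | (∀ k, (Gs (σ k)).deriv π x = c k) ∧
            LinearIndependent ℝ (Sum.elim
              (fun _ : Unit => fun i => x i - x₀ i)
              (fun k : Fin (d - 1) => fun i =>
                fderiv ℝ ((Gs (σ k)).deriv π) x (Pi.single i 1)))}.encard : ℕ∞) ≤ N)

/-- All leaves of the `d`-tree carry indices `< m'`; i.e. the tree is a `d`-tree on the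
first `m'` of the `m` available indices. -/
noncomputable def DTree.leavesLT {d m : ℕ} (m' : ℕ) : DTree d m → Prop :=
  DTree.rec (motive := fun _ => Prop) (fun i => (i : ℕ) < m') (fun _ ih => ∀ k, ih k)

/-- The partial-derivative Jacobian determinant of a family of `d` functions on `ℝ^d`. -/
noncomputable def jacobianDet {d : ℕ} (F : Fin d → (Fin d → ℝ) → ℝ) (x : Fin d → ℝ) : ℝ :=
  (Matrix.of fun r k : Fin d => fderiv ℝ (F k) x (Pi.single r 1)).det

/-- Area inequality: a map with at most `N` nondegenerate preimages of each point. -/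
theorem lintegral_abs_det_mul_comp_le {E : Type*} [NormedAddCommGroup E] [NormedSpace ℝ E]
    [FiniteDimensional ℝ E] [MeasurableSpace E] [BorelSpace E] (μ : Measure E)
    [μ.IsAddHaarMeasure] {s : Set E} {f : E → E} {f' : E → E →L[ℝ] E} (hs : MeasurableSet s)
    (hf' : ∀ x ∈ s, HasFDerivWithinAt f (f' x) s x) (N : ℕ)
    (hN : ∀ y, {x ∈ s | f x = y ∧ (f' x).det ≠ 0}.encard ≤ N)
    {h : E → ℝ≥0∞} (hh : Measurable h) :
    ∫⁻ x in s, ENNReal.ofReal |(f' x).det| * h (f x) ∂μ ≤ N * ∫⁻ y, h y ∂μ := by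
  classical
  have hdet : NullMeasurableSet {x ∈ s | (f' x).det ≠ 0} μ := by
    have h1 : AEMeasurable (fun x => (f' x).det) (μ.restrict s) :=
      ContinuousLinearMap.continuous_det.measurable.comp_aemeasurable
        (aemeasurable_fderivWithin μ hs hf')
    have h2 : NullMeasurableSet {x | (f' x).det ≠ 0} (μ.restrict s) :=
      h1.nullMeasurable (measurableSet_singleton (0 : ℝ)).compl
    have h3 := (nullMeasurableSet_restrict hs.nullMeasurableSet).1 h2
    convert h3 using 1
    ext x; simp [and_comm]
  obtain ⟨s₁, hs₁sub, hs₁m, hs₁ae⟩ := hdet.exists_measurable_subset_ae_eq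
  have hs₁s : s₁ ⊆ s := fun x hx => (hs₁sub hx).1
  have hle : ∫⁻ x in s, ENNReal.ofReal |(f' x).det| * h (f x) ∂μ
      ≤ ∫⁻ x in s₁, ENNReal.ofReal |(f' x).det| * h (f x) ∂μ := by
    rw [← lintegral_indicator hs]
    have : ∀ x, s.indicator (fun x => ENNReal.ofReal |(f' x).det| * h (f x)) x =
        {x ∈ s | (f' x).det ≠ 0}.indicator (fun x => ENNReal.ofReal |(f' x).det| * h (f x)) x := by
      intro x
      by_cases hx : x ∈ s <;> by_cases hd : (f' x).det = 0 <;> simp [Set.indicator, hx, hd]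
    simp_rw [this]
    rw [lintegral_indicator₀ hdet, setLIntegral_congr hs₁ae]
  refine hle.trans ?_
  let r : (E →L[ℝ] E) → NNReal := fun A =>
    if hA : A.det ≠ 0 then
      (if Subsingleton E then 1 else ‖((A.toContinuousLinearEquivOfDetNeZero hA).symm : E →L[ℝ] E)‖₊⁻¹ / 2)
    else 1
  have rpos : ∀ A, r A ≠ 0 := by
    intro A
    by_cases hA : A.det ≠ 0
    · by_cases hE : Subsingleton E
      · simp [r, hE]
      · simp only [r, hA, hE, dif_pos, if_false, ne_eq, not_false_eq_true]
        have : Nontrivial E := not_subsingleton_iff_nontrivial.1 hE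
        have h0 : 0 < ‖((A.toContinuousLinearEquivOfDetNeZero hA).symm : E →L[ℝ] E)‖₊ :=
          (A.toContinuousLinearEquivOfDetNeZero hA).nnnorm_symm_pos
        positivity
    · simp only [ne_eq, not_not] at hA; simp [r, hA]
  obtain ⟨t, A, tdisj, tmeas, hst, happ, hA⟩ :=
    exists_partition_approximatesLinearOn_of_hasFDerivWithinAt f s₁ f'
      (fun x hx => (hf' x (hs₁s hx)).mono hs₁s) r rpos
  have hinj : ∀ n, Set.InjOn f (s₁ ∩ t n) := by
    intro n
    rcases s₁.eq_empty_or_nonempty with he | hne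
    · simp [he]
    obtain ⟨y, hy, hAy⟩ := hA hne n
    have hAd : (A n).det ≠ 0 := by rw [hAy]; exact (hs₁sub hy).2
    have := happ n
    have hc : ((A n).toContinuousLinearEquivOfDetNeZero hAd : E →L[ℝ] E) = A n := by
      ext; simp
    rw [← hc] at this
    refine this.injOn ?_
    rw [hc]
    by_cases hE : Subsingleton E
    · exact Or.inl hE
    · right
      have hE' : Nontrivial E := not_subsingleton_iff_nontrivial.1 hE
      simp only [r, hAd, hE, dif_pos, if_false, ne_eq, not_false_eq_true]
      apply NNReal.half_lt_self
      exact (inv_pos.2 ((A n).toContinuousLinearEquivOfDetNeZero hAd).nnnorm_symm_pos).ne'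
  have hder : ∀ n, ∀ x ∈ s₁ ∩ t n, HasFDerivWithinAt f (f' x) (s₁ ∩ t n) x := fun n x hx =>
    (hf' x (hs₁s hx.1)).mono (Set.inter_subset_left.trans hs₁s)
  have hmeas : ∀ n, MeasurableSet (s₁ ∩ t n) := fun n => hs₁m.inter (tmeas n)
  have himg : ∀ n, MeasurableSet (f '' (s₁ ∩ t n)) := fun n =>
    measurable_image_of_fderivWithin (hmeas n) (hder n) (hinj n)
  have hunion : s₁ = ⋃ n, s₁ ∩ t n := by
    rw [← Set.inter_iUnion]; exact (Set.inter_eq_left.2 hst).symm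
  have hcalc : ∫⁻ x in s₁, ENNReal.ofReal |(f' x).det| * h (f x) ∂μ
      = ∫⁻ y, ∑' n, (f '' (s₁ ∩ t n)).indicator h y ∂μ := by
    conv_lhs => rw [hunion]
    rw [lintegral_iUnion hmeas (fun i j hij => (tdisj hij).mono Set.inter_subset_right
      Set.inter_subset_right), lintegral_tsum (fun n => (hh.indicator (himg n)).aemeasurable)]
    congr 1; ext n
    rw [← lintegral_image_eq_lintegral_abs_det_fderiv_mul μ (hmeas n) (hder n) (hinj n),
      lintegral_indicator (himg n)]
  rw [hcalc, ← lintegral_const_mul _ hh]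
  refine lintegral_mono fun y => ?_
  rw [ENNReal.tsum_eq_iSup_sum]
  refine iSup_le fun T => ?_
  set T' := T.filter fun n => y ∈ f '' (s₁ ∩ t n)
  have hsum : ∑ n ∈ T, (f '' (s₁ ∩ t n)).indicator h y = T'.card * h y := by
    simp only [Set.indicator_apply]
    rw [← Finset.sum_filter, Finset.sum_const, nsmul_eq_mul]
  rw [hsum]
  gcongr
  have hch : ∀ n : T', ∃ x ∈ s₁ ∩ t n, f x = y := fun n => (Finset.mem_filter.1 n.2).2
  choose g hg hgy using hch
  have ginj : Function.Injective g := by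
    intro a b hab
    by_contra hne
    have hne' : (a : ℕ) ≠ b := fun h => hne (Subtype.ext h)
    exact Set.disjoint_left.1 (tdisj hne') (hg a).2 (hab ▸ (hg b).2)
  have hcard : (T'.card : ℕ∞) ≤ N := by
    calc (T'.card : ℕ∞) = (Set.range g).encard := by
            rw [← Set.image_univ, ginj.encard_image, Set.encard_univ]; simp
      _ ≤ _ := Set.encard_le_encard (by
            rintro _ ⟨n, rfl⟩
            exact ⟨hs₁s (hg n).1, hgy n, (hs₁sub (hg n).1).2⟩)
      _ ≤ N := hN y
  exact_mod_cast hcard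

section Jacobian
variable {d : ℕ} {F : Fin d → (Fin d → ℝ) → ℝ} {U B : Set (Fin d → ℝ)} {k₀ : Fin d}
  {x : Fin d → ℝ}

/-- The matrix of partial derivatives, one column per function. -/
noncomputable def gradMatrix (F : Fin d → (Fin d → ℝ) → ℝ) (x : Fin d → ℝ) :
    Matrix (Fin d) (Fin d) ℝ :=
  Matrix.of fun r k => fderiv ℝ (F k) x (Pi.single r 1)

theorem jacobianDet_update (F : Fin d → (Fin d → ℝ) → ℝ) (k₀ : Fin d) (v : (Fin d → ℝ) → ℝ)
    (x : Fin d → ℝ) :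
    jacobianDet (Function.update F k₀ v) x =
      ((gradMatrix F x).updateCol k₀ fun r => fderiv ℝ v x (Pi.single r 1)).det := by
  unfold jacobianDet gradMatrix
  congr 1
  ext r k
  by_cases h : k = k₀
  · subst h; simp
  · simp [h]

theorem jacobianDet_update_mul {a b : (Fin d → ℝ) → ℝ} (ha : DifferentiableAt ℝ a x)
    (hb : DifferentiableAt ℝ b x) :
    jacobianDet (Function.update F k₀ fun x => a x * b x) x =
      a x * jacobianDet (Function.update F k₀ b) x +
        b x * jacobianDet (Function.update F k₀ a) x := by
  simp only [jacobianDet_update]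
  rw [← Matrix.det_updateCol_smul, ← Matrix.det_updateCol_smul, ← Matrix.det_updateCol_add]
  congr 2
  ext r
  rw [fderiv_fun_mul ha hb]
  simp

theorem jacobianDet_update_comp {χ : ℝ → ℝ} {g : (Fin d → ℝ) → ℝ}
    (hχ : DifferentiableAt ℝ χ (g x)) (hg : DifferentiableAt ℝ g x) :
    jacobianDet (Function.update F k₀ fun x => χ (g x)) x =
      deriv χ (g x) * jacobianDet (Function.update F k₀ g) x := by
  simp only [jacobianDet_update]
  rw [← Matrix.det_updateCol_smul]
  congr 2
  ext r
  have := (hχ.hasDerivAt.comp_hasFDerivAt x hg.hasFDerivAt).fderiv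
  change fderiv ℝ (χ ∘ g) x _ = _
  rw [this]
  simp

theorem jacobianDet_update_eq_zero {v : (Fin d → ℝ) → ℝ} (hv : fderiv ℝ v x = 0) :
    jacobianDet (Function.update F k₀ v) x = 0 := by
  rw [jacobianDet_update]
  apply Matrix.det_eq_zero_of_column_eq_zero k₀
  simp [hv]

theorem jacobianDet_eq_zero_of_eq {i j : Fin d} (hij : i ≠ j) (h : F i = F j) :
    jacobianDet F x = 0 := by
  unfold jacobianDet
  apply Matrix.det_zero_of_column_eq hij
  simp [h]

theorem continuousOn_gradMatrix (hU : IsOpen U) (hF : ∀ k, ContDiffOn ℝ 1 (F k) U) :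
    ContinuousOn (gradMatrix F) U := by
  refine continuousOn_pi.2 fun r => continuousOn_pi.2 fun k => ?_
  exact ((hF k).continuousOn_fderiv_of_isOpen hU le_rfl).clm_apply continuousOn_const

theorem continuousOn_jacobianDet (hU : IsOpen U) (hF : ∀ k, ContDiffOn ℝ 1 (F k) U) :
    ContinuousOn (jacobianDet F) U :=
  Continuous.comp_continuousOn (Continuous.matrix_det continuous_id)
    (continuousOn_gradMatrix hU hF)

theorem contDiffOn_update {n : WithTop ℕ∞} {v : (Fin d → ℝ) → ℝ}
    (hF : ∀ k, ContDiffOn ℝ n (F k) U) (hv : ContDiffOn ℝ n v U) (k : Fin d) :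
    ContDiffOn ℝ n (Function.update F k₀ v k) U := by
  by_cases h : k = k₀
  · subst h; simpa using hv
  · simpa [h] using hF k

theorem det_pi_fderiv {f : Fin d → (Fin d → ℝ) → ℝ} (x : Fin d → ℝ) :
    (ContinuousLinearMap.pi fun k => fderiv ℝ (f k) x).det = jacobianDet f x := by
  rw [ContinuousLinearMap.det, ← LinearMap.det_toMatrix', ← Matrix.det_transpose]
  unfold jacobianDet
  congr 1

/-- Area inequality for a family of `d` functions. -/
theorem lintegral_jacobianDet_mul_le {s : Set (Fin d → ℝ)} (hs : MeasurableSet s)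
    (hF : ∀ x ∈ s, ∀ k, DifferentiableAt ℝ (F k) x) (N : ℕ)
    (hN : ∀ y : Fin d → ℝ, {x ∈ s | (∀ k, F k x = y k) ∧ jacobianDet F x ≠ 0}.encard ≤ N)
    {h : (Fin d → ℝ) → ℝ≥0∞} (hh : Measurable h) :
    ∫⁻ x in s, ENNReal.ofReal |jacobianDet F x| * h (fun k => F k x) ≤ N * ∫⁻ y, h y := by
  have := lintegral_abs_det_mul_comp_le (volume : Measure (Fin d → ℝ)) hs
    (f := fun x k => F k x) (f' := fun x => ContinuousLinearMap.pi fun k => fderiv ℝ (F k) x)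
    (fun x hx => (hasFDerivAt_pi.2 fun k => (hF x hx k).hasFDerivAt).hasFDerivWithinAt) N
    (fun y => by
      convert hN y using 6 with x
      · exact funext_iff
      · rw [det_pi_fderiv]) hh
  simpa only [det_pi_fderiv] using this

theorem integral_fderiv_apply_eq_zero {W : (Fin d → ℝ) → ℝ} (hU : IsOpen U) (hB : IsCompact B)
    (hBU : B ⊆ U) (hW : ContDiffOn ℝ 1 W U) (h0 : ∀ x ∉ B, W x = 0) (e : Fin d → ℝ) :
    ∫ x, fderiv ℝ W x e = 0 := by
  have hcont : ContDiff ℝ 1 W := by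
    rw [contDiff_iff_contDiffAt]
    intro x
    by_cases hx : x ∈ B
    · exact hW.contDiffAt (hU.mem_nhds (hBU hx))
    · have : W =ᶠ[nhds x] fun _ => 0 := by
        filter_upwards [hB.isClosed.isOpen_compl.mem_nhds hx] with y hy using h0 y hy
      exact contDiffAt_const.congr_of_eventuallyEq this
  have hsupp : HasCompactSupport W := HasCompactSupport.intro hB h0
  have hi := hcont.continuous.integrable_of_hasCompactSupport (μ := volume) hsupp
  have hi' : Integrable (fun x => fderiv ℝ W x e) := by
    apply Continuous.integrable_of_hasCompactSupport
    · exact (hcont.continuous_fderiv one_ne_zero).clm_apply continuous_const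
    · exact hsupp.fderiv_apply ℝ e
  have := integral_mul_fderiv_eq_neg_fderiv_mul_of_integrable (μ := (volume : Measure (Fin d → ℝ)))
    (f := fun _ => (1 : ℝ)) (g := W) (v := e) (by simp) (by simpa using hi') (by simpa using hi)
    (by simp) (fun x _ => (hcont.differentiable one_ne_zero) x)
  simpa using this

open Equiv in
theorem jacobianDet_update_eq_sum {v : (Fin d → ℝ) → ℝ} (hU : IsOpen U)
    (hF : ∀ k, ContDiffOn ℝ 2 (F k) U) (hv : ContDiffOn ℝ 1 v U) (hx : x ∈ U) :
    jacobianDet (Function.update F k₀ v) x =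
      ∑ σ : Perm (Fin d), (Perm.sign σ : ℝ) *
        fderiv ℝ (fun x => v x * ∏ k ∈ Finset.univ.erase k₀,
          fderiv ℝ (F k) x (Pi.single (σ k) 1)) x (Pi.single (σ k₀) 1) := by
  have hU' := hU.mem_nhds hx
  have hvd : DifferentiableAt ℝ v x := (hv.contDiffAt hU').differentiableAt one_ne_zero
  have hFd : ∀ k, ∀ w : Fin d → ℝ, DifferentiableAt ℝ (fun x => fderiv ℝ (F k) x w) x := by
    intro k w
    have : ContDiffAt ℝ 1 (fderiv ℝ (F k)) x :=
      ((hF k).contDiffAt hU').fderiv_right (by norm_num [one_add_one_eq_two])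
    exact (this.differentiableAt one_ne_zero).clm_apply (differentiableAt_const _)
  set H : Fin d → Fin d → Fin d → ℝ := fun l a b =>
    fderiv ℝ (fun x => fderiv ℝ (F l) x (Pi.single a 1)) x (Pi.single b 1) with hH
  have hsymm : ∀ l a b, H l a b = H l b a := by
    intro l a b
    have h2 : ContDiffAt ℝ 2 (F l) x := (hF l).contDiffAt hU'
    have hd : DifferentiableAt ℝ (fderiv ℝ (F l)) x :=
      (h2.fderiv_right (m := 1) (by norm_num [one_add_one_eq_two])).differentiableAt one_ne_zero
    have key : ∀ a b, H l a b = fderiv ℝ (fderiv ℝ (F l)) x (Pi.single b 1) (Pi.single a 1) := by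
      intro a b
      simp only [hH]
      rw [fderiv_clm_apply hd (differentiableAt_const _)]
      simp
    rw [key, key]
    exact (h2.isSymmSndFDerivAt (by simp [minSmoothness_of_isRCLikeNormedField])) _ _
  have hterm : ∀ σ : Perm (Fin d),
      fderiv ℝ (fun x => v x * ∏ k ∈ Finset.univ.erase k₀,
          fderiv ℝ (F k) x (Pi.single (σ k) 1)) x (Pi.single (σ k₀) 1) =
      fderiv ℝ v x (Pi.single (σ k₀) 1) * ∏ k ∈ Finset.univ.erase k₀,
          fderiv ℝ (F k) x (Pi.single (σ k) 1) +
      v x * ∑ l ∈ Finset.univ.erase k₀, (∏ k ∈ (Finset.univ.erase k₀).erase l,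
        fderiv ℝ (F k) x (Pi.single (σ k) 1)) * H l (σ l) (σ k₀) := by
    intro σ
    have hp : HasFDerivAt (fun x => ∏ k ∈ Finset.univ.erase k₀,
          fderiv ℝ (F k) x (Pi.single (σ k) 1)) _ x :=
      HasFDerivAt.finsetProd (fun k _ => (hFd k (Pi.single (σ k) 1)).hasFDerivAt)
    rw [(hvd.hasFDerivAt.fun_mul hp).fderiv]
    simp [hH, mul_comm, add_comm]
  simp only [hterm, mul_add, Finset.sum_add_distrib]
  have hzero : ∑ σ : Perm (Fin d), (Perm.sign σ : ℝ) *
      (v x * ∑ l ∈ Finset.univ.erase k₀, (∏ k ∈ (Finset.univ.erase k₀).erase l,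
        fderiv ℝ (F k) x (Pi.single (σ k) 1)) * H l (σ l) (σ k₀)) = 0 := by
    simp only [Finset.mul_sum]
    rw [Finset.sum_comm]
    refine Finset.sum_eq_zero fun l hl => ?_
    have hl' : l ≠ k₀ := Finset.ne_of_mem_erase hl
    set g : Perm (Fin d) → ℝ := fun σ => (Perm.sign σ : ℝ) *
      (v x * ((∏ k ∈ (Finset.univ.erase k₀).erase l,
        fderiv ℝ (F k) x (Pi.single (σ k) 1)) * H l (σ l) (σ k₀))) with hg
    have h1 : ∑ σ, g σ = ∑ σ, g (σ * swap k₀ l) :=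
      (Equiv.sum_comp (Equiv.mulRight (swap k₀ l)) g).symm
    have h2 : ∀ σ, g (σ * swap k₀ l) = - g σ := by
      intro σ
      have hprod : ∏ k ∈ (Finset.univ.erase k₀).erase l,
          fderiv ℝ (F k) x (Pi.single ((σ * swap k₀ l) k) 1) =
          ∏ k ∈ (Finset.univ.erase k₀).erase l, fderiv ℝ (F k) x (Pi.single (σ k) 1) := by
        refine Finset.prod_congr rfl fun k hk => ?_
        have hkl : k ≠ l := Finset.ne_of_mem_erase hk
        have hk0 : k ≠ k₀ := Finset.ne_of_mem_erase (Finset.mem_of_mem_erase hk)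
        rw [Perm.mul_apply, swap_apply_of_ne_of_ne hk0 hkl]
      simp only [hg, hprod]
      rw [Perm.sign_mul, Perm.sign_swap hl'.symm, Perm.mul_apply, Perm.mul_apply,
        swap_apply_right, swap_apply_left, hsymm l (σ k₀) (σ l)]
      simp
    rw [Finset.sum_congr rfl fun σ _ => h2 σ, Finset.sum_neg_distrib] at h1
    change ∑ σ, g σ = 0
    linarith
  rw [hzero, add_zero, jacobianDet_update, Matrix.det_apply']
  refine Finset.sum_congr rfl fun σ _ => ?_
  rw [← Finset.mul_prod_erase _ _ (Finset.mem_univ k₀)]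
  congr 1
  rw [Matrix.updateCol_self]
  congr 1
  refine Finset.prod_congr rfl fun k hk => ?_
  rw [Matrix.updateCol_ne (Finset.ne_of_mem_erase hk)]
  rfl

open Equiv in
theorem integral_jacobianDet_update_eq_zero {v : (Fin d → ℝ) → ℝ} (hU : IsOpen U)
    (hB : IsCompact B) (hBU : B ⊆ U) (hF : ∀ k, ContDiffOn ℝ 2 (F k) U)
    (hv : ContDiffOn ℝ 1 v U) (h0 : ∀ x ∉ B, v x = 0) :
    ∫ x in B, jacobianDet (Function.update F k₀ v) x = 0 := by
  set W : Perm (Fin d) → (Fin d → ℝ) → ℝ := fun σ x => v x * ∏ k ∈ Finset.univ.erase k₀,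
    fderiv ℝ (F k) x (Pi.single (σ k) 1) with hWdef
  have hW : ∀ σ, ContDiffOn ℝ 1 (W σ) U := by
    intro σ
    refine hv.mul (contDiffOn_prod fun k _ => ?_)
    exact ((hF k).fderiv_of_isOpen hU (by norm_num [one_add_one_eq_two])).clm_apply
      contDiffOn_const
  have hW0 : ∀ σ, ∀ x ∉ B, W σ x = 0 := fun σ x hx => by simp [hWdef, h0 x hx]
  have hWd0 : ∀ σ, ∀ x ∉ B, fderiv ℝ (W σ) x = 0 := by
    intro σ x hx
    have : W σ =ᶠ[nhds x] fun _ => 0 := by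
      filter_upwards [hB.isClosed.isOpen_compl.mem_nhds hx] with y hy using hW0 σ y hy
    rw [this.fderiv_eq]; simp
  have hfint : ∀ σ : Perm (Fin d), IntegrableOn
      (fun x => fderiv ℝ (W σ) x (Pi.single (σ k₀) 1)) B := fun σ =>
    ((((hW σ).continuousOn_fderiv_of_isOpen hU le_rfl).clm_apply
      continuousOn_const).mono hBU).integrableOn_compact hB
  rw [setIntegral_congr_fun hB.measurableSet
    (fun x hx => jacobianDet_update_eq_sum hU hF hv (hBU hx))]
  rw [integral_finsetSum _ fun σ _ => (hfint σ).const_mul _]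
  refine Finset.sum_eq_zero fun σ _ => ?_
  rw [integral_const_mul]
  rw [setIntegral_eq_integral_of_forall_compl_eq_zero fun x hx => by rw [hWd0 σ x hx]; simp]
  rw [integral_fderiv_apply_eq_zero hU hB hBU (hW σ) (hW0 σ), mul_zero]

end Jacobian

theorem isClosed_inter_abs_le {d : ℕ} {F : Fin d → (Fin d → ℝ) → ℝ} {s : Set (Fin d → ℝ)}
    (hs : IsClosed s) (hF : ∀ k, ContinuousOn (F k) s) (k₀ : Fin d) (η : Fin d → ℝ) :
    IsClosed (s ∩ {x | ∀ k ≠ k₀, |F k x| ≤ η k}) := by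
  have : s ∩ {x | ∀ k ≠ k₀, |F k x| ≤ η k} =
      s ∩ (fun x k => |F k x|) ⁻¹' {y | ∀ k ≠ k₀, y k ≤ η k} := rfl
  rw [this]
  refine ContinuousOn.preimage_isClosed_of_isClosed
    (continuousOn_pi.2 fun k => (hF k).abs) hs ?_
  simp only [Set.ofPred_forall]
  exact isClosed_iInter fun k => isClosed_iInter fun _ =>
    isClosed_le (continuous_apply k) continuous_const

theorem setIntegral_abs_jacobianDet_mul_le {d : ℕ} {F : Fin d → (Fin d → ℝ) → ℝ}
    {s : Set (Fin d → ℝ)} (hs : IsCompact s) (hF : ∀ x ∈ s, ∀ k, DifferentiableAt ℝ (F k) x)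
    (hJ : ContinuousOn (jacobianDet F) s) (N : ℕ)
    (hN : ∀ y : Fin d → ℝ, {x ∈ s | (∀ k, F k x = y k) ∧ jacobianDet F x ≠ 0}.encard ≤ N)
    (k₀ : Fin d) {g : ℝ → ℝ} (hg : Continuous g) (hg0 : ∀ t, 0 ≤ g t) (hgi : Integrable g)
    {η : Fin d → ℝ} (hη : ∀ k, 0 ≤ η k) :
    ∫ x in s ∩ {x | ∀ k ≠ k₀, |F k x| ≤ η k}, |jacobianDet F x| * g (F k₀ x) ≤
      N * (∫ t, g t) * ∏ k ∈ Finset.univ.erase k₀, (2 * η k) := by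
  classical
  have hFc : ∀ k, ContinuousOn (F k) s := fun k x hx => (hF x hx k).continuousAt.continuousWithinAt
  have hclosed : IsClosed (s ∩ {x | ∀ k ≠ k₀, |F k x| ≤ η k}) :=
    isClosed_inter_abs_le hs.isClosed hFc k₀ η
  set E := s ∩ {x | ∀ k ≠ k₀, |F k x| ≤ η k} with hE
  have hEs : E ⊆ s := Set.inter_subset_left
  let φ : Fin d → ℝ → ℝ := fun k => if k = k₀ then g else (Set.Icc (-η k) (η k)).indicator 1
  have hφ0 : ∀ k t, 0 ≤ φ k t := by
    intro k t
    by_cases h : k = k₀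
    · simpa [φ, h] using hg0 t
    · simp only [φ, h, if_false]; exact Set.indicator_nonneg (fun _ _ => zero_le_one) _
  have hφm : ∀ k, Measurable (φ k) := by
    intro k
    by_cases h : k = k₀
    · simpa [φ, h] using hg.measurable
    · simp only [φ, h, if_false]; exact measurable_one.indicator measurableSet_Icc
  have hφi : ∀ k, Integrable (φ k) := by
    intro k
    by_cases h : k = k₀
    · simpa [φ, h] using hgi
    · simp only [φ, h, if_false]
      exact (integrable_indicator_iff measurableSet_Icc).2 (by simp [Pi.one_def])
  have hφint : ∏ k, ∫ t, φ k t = (∫ t, g t) * ∏ k ∈ Finset.univ.erase k₀, (2 * η k) := by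
    rw [← Finset.mul_prod_erase _ _ (Finset.mem_univ k₀)]
    congr 1
    · simp [φ]
    · refine Finset.prod_congr rfl fun k hk => ?_
      have h : k ≠ k₀ := Finset.ne_of_mem_erase hk
      simp only [φ, h, if_false]
      rw [integral_indicator_one measurableSet_Icc, Real.volume_real_Icc_of_le (by linarith [hη k])]
      ring
  have hH : Measurable fun y : Fin d → ℝ => ENNReal.ofReal (∏ k, φ k (y k)) :=
    (Finset.measurable_prod _ fun k _ => (hφm k).comp (measurable_pi_apply k)).ennreal_ofReal
  have hNE : ∀ y : Fin d → ℝ,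
      {x ∈ E | (∀ k, F k x = y k) ∧ jacobianDet F x ≠ 0}.encard ≤ N := fun y =>
    (Set.encard_le_encard (Set.inter_subset_inter_left _ hEs)).trans (hN y)
  have key := lintegral_jacobianDet_mul_le hclosed.measurableSet
    (fun x hx => hF x (hEs hx)) N hNE hH
  have hpi : Integrable (fun y : Fin d → ℝ => ∏ k, φ k (y k)) volume :=
    Integrable.fintype_prod (μ := fun _ => volume) hφi
  rw [← ofReal_integral_eq_lintegral_ofReal hpi
    (Filter.Eventually.of_forall fun y => Finset.prod_nonneg fun k _ => hφ0 k _),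
    integral_fintype_prod_volume_eq_prod, hφint] at key
  have hgint : 0 ≤ ∫ t, g t := integral_nonneg hg0
  have hprod : 0 ≤ ∏ k ∈ Finset.univ.erase k₀, (2 * η k) :=
    Finset.prod_nonneg fun k _ => by linarith [hη k]
  rw [integral_eq_lintegral_of_nonneg_ae
    (Filter.Eventually.of_forall fun x => mul_nonneg (abs_nonneg _) (hg0 _))
    (((hJ.mono hEs).abs.mul (hg.comp_continuousOn ((hFc k₀).mono hEs))).aestronglyMeasurable
      hclosed.measurableSet)]
  refine ENNReal.toReal_le_of_le_ofReal (by positivity) ?_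
  rw [mul_assoc, ENNReal.ofReal_mul (by positivity), ENNReal.ofReal_natCast]
  refine le_trans (le_of_eq ?_) key
  refine setLIntegral_congr_fun hclosed.measurableSet fun x hx => ?_
  simp only []
  rw [ENNReal.ofReal_mul (abs_nonneg _)]
  congr 2
  rw [← Finset.mul_prod_erase _ _ (Finset.mem_univ k₀), Finset.prod_eq_one, mul_one]
  · simp [φ]
  · intro k hk
    have h : k ≠ k₀ := Finset.ne_of_mem_erase hk
    simp [φ, h, abs_le.1 (hx.2 k h)]

theorem integrable_of_abs_le_inv_sq {g : ℝ → ℝ} (hg : Continuous g)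
    (h : ∀ u, 1 < |u| → |g u| ≤ 1 / u ^ 2) : Integrable g := by
  obtain ⟨C, hC⟩ := (isCompact_Icc (a := (-1 : ℝ)) (b := 1)).exists_bound_of_continuousOn
    hg.continuousOn
  have hC0 : 0 ≤ C := (norm_nonneg _).trans (hC 0 (by norm_num))
  refine ((integrable_inv_one_add_sq).const_mul (2 * C + 2)).mono' hg.aestronglyMeasurable
    (Filter.Eventually.of_forall fun u => ?_)
  rw [← div_eq_mul_inv, le_div_iff₀ (by positivity)]
  by_cases hu : 1 < |u|
  · have h1 : 1 < u ^ 2 := by rw [← sq_abs]; nlinarith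
    have := h u hu
    rw [le_div_iff₀ (by positivity)] at this
    rw [Real.norm_eq_abs]
    nlinarith [abs_nonneg (g u)]
  · have hu' := abs_le.1 (not_lt.1 hu)
    have := hC u hu'
    have hu2 : u ^ 2 ≤ 1 := by nlinarith
    nlinarith [norm_nonneg (g u), mul_le_mul this hu2 (sq_nonneg u) hC0]

theorem exists_det_eq_mul_det_updateCol {n : Type*} [Fintype n] [DecidableEq n] {A M : Matrix n n ℝ}
    {ν β : n → ℝ} {α : ℝ} {k₀ : n} (hα : 1 ≤ α) (h0 : ∀ r, M r k₀ = 2 * ν r)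
    (h : ∀ k ≠ k₀, ∀ r, M r k = α * A r k + β k * ν r) :
    ∃ γ : ℝ, 2 ≤ |γ| ∧ M.det = γ * (A.updateCol k₀ ν).det := by
  set v : n → ℝ := fun k => if k = k₀ then 2 else α with hv
  have hM : M.det = (Matrix.of fun r k => v k * (A.updateCol k₀ ν) r k).det := by
    rw [← Matrix.det_transpose M, ← Matrix.det_transpose (Matrix.of _)]
    refine Matrix.det_eq_of_forall_row_eq_smul_add_const
      (fun k => if k = k₀ then 0 else β k / 2) k₀ (by simp) fun k r => ?_
    by_cases hk : k = k₀
    · subst hk; simp [hv, h0]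
    · simp [hv, hk, h k hk]; ring
  refine ⟨∏ k, v k, ?_, by rw [hM, Matrix.det_mul_row]⟩
  rw [← Finset.mul_prod_erase _ _ (Finset.mem_univ k₀), abs_mul]
  have h1 : (1 : ℝ) ≤ ∏ k ∈ Finset.univ.erase k₀, v k := by
    refine Finset.prod_induction v (fun t => 1 ≤ t) (fun a b => one_le_mul_of_one_le_of_one_le)
      le_rfl fun k hk => ?_
    simpa [hv, Finset.ne_of_mem_erase hk] using hα
  have h2 : |v k₀| = 2 := by simp [hv]
  rw [h2]
  have := le_abs_self (∏ k ∈ Finset.univ.erase k₀, v k)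
  linarith

section Ball
variable {d : ℕ}

/-- The squared Euclidean distance to `x₀`. -/
noncomputable def sqDist (x₀ x : Fin d → ℝ) : ℝ := ∑ i, (x i - x₀ i) ^ 2

theorem contDiff_sqDist (x₀ : Fin d → ℝ) : ContDiff ℝ ⊤ (sqDist x₀) := by
  unfold sqDist; fun_prop

theorem fderiv_sqDist (x₀ x : Fin d → ℝ) (r : Fin d) :
    fderiv ℝ (sqDist x₀) x (Pi.single r 1) = 2 * (x r - x₀ r) := by
  have : HasFDerivAt (sqDist x₀) (∑ i, (2 * (x i - x₀ i)) •
      (ContinuousLinearMap.proj i : (Fin d → ℝ) →L[ℝ] ℝ)) x := by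
    unfold sqDist
    refine HasFDerivAt.fun_sum fun i _ => ?_
    have h := ((ContinuousLinearMap.proj (R := ℝ) (φ := fun _ : Fin d => ℝ) i).hasFDerivAt
      (x := x)).sub_const (x₀ i)
    simpa using h.pow 2
  rw [this.fderiv]
  simp [Pi.single_apply]

theorem sqDist_add_smul (x₀ x : Fin d → ℝ) (s : ℝ) :
    sqDist x₀ (x₀ + s • (x - x₀)) = s ^ 2 * sqDist x₀ x := by
  simp [sqDist, Finset.mul_sum, mul_pow]

theorem isCompact_sqDist_le (x₀ : Fin d → ℝ) (R : ℝ) : IsCompact {x | sqDist x₀ x ≤ R ^ 2} := by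
  refine Metric.isCompact_of_isClosed_isBounded
    (isClosed_le (contDiff_sqDist x₀).continuous continuous_const) ?_
  refine (Metric.isBounded_closedBall (x := x₀) (r := |R|)).subset fun x hx => ?_
  rw [Metric.mem_closedBall, dist_pi_le_iff (abs_nonneg _)]
  intro i
  rw [Real.dist_eq]
  refine sq_le_sq.1 (le_trans ?_ hx)
  exact Finset.single_le_sum (f := fun i => (x i - x₀ i) ^ 2) (fun _ _ => sq_nonneg _)
    (Finset.mem_univ i)

theorem volume_annulus_le (x₀ : Fin d → ℝ) {R h : ℝ} (hR : 0 < R) (hh : 0 < h) (hhR : h < R ^ 2) :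
    volume.real {x | sqDist x₀ x ≤ R ^ 2 ∧ R ^ 2 - h ≤ sqDist x₀ x} ≤
      d / R ^ 2 * volume.real {x | sqDist x₀ x ≤ R ^ 2} * h := by
  set B := {x | sqDist x₀ x ≤ R ^ 2} with hB
  set τ := h / R ^ 2 with hτ
  have hτ0 : 0 < τ := by positivity
  have hτ1 : τ < 1 := (div_lt_one (by positivity)).2 hhR
  have hhτ : h = τ * R ^ 2 := by rw [hτ]; field_simp
  have hBc : IsCompact B := isCompact_sqDist_le x₀ R
  set I := AffineMap.homothety x₀ (1 - τ) '' B with hI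
  have hIc : IsCompact I := hBc.image (AffineMap.homothety_continuous x₀ (1 - τ))
  have hIq : ∀ x ∈ I, sqDist x₀ x ≤ (1 - τ) ^ 2 * R ^ 2 := by
    rintro _ ⟨x, hx, rfl⟩
    have : AffineMap.homothety x₀ (1 - τ) x = x₀ + (1 - τ) • (x - x₀) := by
      simp [AffineMap.homothety_apply, add_comm]
    rw [this, sqDist_add_smul]
    exact mul_le_mul_of_nonneg_left hx (sq_nonneg _)
  have hIB : I ⊆ B := fun x hx => (hIq x hx).trans (by
    have : (1 - τ) ^ 2 ≤ 1 := by nlinarith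
    nlinarith [sq_nonneg R])
  have hsub : {x | sqDist x₀ x ≤ R ^ 2 ∧ R ^ 2 - h ≤ sqDist x₀ x} ⊆ B \ I := by
    intro x hx
    refine ⟨hx.1, fun hxI => ?_⟩
    have h1 := hIq x hxI
    have h2 := hx.2
    rw [hhτ] at h2
    have : 0 < τ * (1 - τ) * R ^ 2 := by have := sub_pos.2 hτ1; positivity
    nlinarith
  have hIv : volume.real I = (1 - τ) ^ d * volume.real B := by
    have h1 : 0 ≤ (1 - τ) ^ d := pow_nonneg (by linarith) _
    rw [hI, Measure.real, Measure.addHaar_image_homothety, ENNReal.toReal_mul,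
      ENNReal.toReal_ofReal (abs_nonneg _), Module.finrank_fin_fun, abs_of_nonneg h1]
    rfl
  calc volume.real {x | sqDist x₀ x ≤ R ^ 2 ∧ R ^ 2 - h ≤ sqDist x₀ x}
      ≤ volume.real (B \ I) := measureReal_mono hsub
        (ne_top_of_le_ne_top hBc.measure_lt_top.ne (measure_mono Set.sdiff_subset))
    _ = volume.real B - volume.real I := by
        rw [measureReal_sdiff hIB hIc.measurableSet hBc.measure_lt_top.ne]
    _ ≤ d * τ * volume.real B := by
        rw [hIv]
        have hb := one_add_mul_le_pow (a := -τ) (by linarith) d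
        have : (1 : ℝ) + -τ = 1 - τ := by ring
        rw [this] at hb
        nlinarith [measureReal_nonneg (μ := (volume : Measure (Fin d → ℝ))) (s := B)]
    _ = _ := by rw [hτ]; ring

end Ball

theorem deriv_smoothTransition_eq_zero {t : ℝ} (ht : 1 < t ∨ t < 0) :
    deriv Real.smoothTransition t = 0 := by
  rcases ht with ht | ht
  · have : Real.smoothTransition =ᶠ[nhds t] fun _ => 1 := by
      filter_upwards [lt_mem_nhds ht] with s hs using Real.smoothTransition.one_of_one_le hs.le
    rw [this.deriv_eq]; simp
  · have : Real.smoothTransition =ᶠ[nhds t] fun _ => 0 := by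
      filter_upwards [gt_mem_nhds ht] with s hs using Real.smoothTransition.zero_of_nonpos hs.le
    rw [this.deriv_eq]; simp

theorem contDiff_smoothTransition : ContDiff ℝ 1 Real.smoothTransition :=
  Real.smoothTransition.contDiff (n := 1)

theorem continuous_deriv_smoothTransition : Continuous (deriv Real.smoothTransition) :=
  contDiff_smoothTransition.continuous_deriv le_rfl

theorem integrable_deriv_smoothTransition : Integrable (deriv Real.smoothTransition) := by
  refine integrable_of_abs_le_inv_sq continuous_deriv_smoothTransition fun u hu => ?_
  rw [deriv_smoothTransition_eq_zero]
  · simp; positivity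
  · rcases lt_abs.1 hu with h | h
    · exact Or.inl h
    · exact Or.inr (by linarith)

theorem exists_abs_deriv_smoothTransition_le :
    ∃ C, 0 ≤ C ∧ ∀ t, |deriv Real.smoothTransition t| ≤ C := by
  obtain ⟨C, hC⟩ := (isCompact_Icc (a := (0 : ℝ)) (b := 1)).exists_bound_of_continuousOn
    continuous_deriv_smoothTransition.continuousOn
  have hC0 : 0 ≤ C := (norm_nonneg _).trans (hC 0 (by norm_num))
  refine ⟨C, hC0, fun t => ?_⟩
  by_cases ht : t ∈ Set.Icc (0 : ℝ) 1
  · exact hC t ht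
  · rw [deriv_smoothTransition_eq_zero]
    · simpa using hC0
    · by_contra! h
      exact ht ⟨h.2, h.1⟩

section Ball
variable {d : ℕ}

/-- Radial projection onto the sphere of center `x₀` and radius `R`. -/
noncomputable def sphereProj (x₀ : Fin d → ℝ) (R : ℝ) (x : Fin d → ℝ) : Fin d → ℝ :=
  x₀ + (R / √(sqDist x₀ x)) • (x - x₀)

theorem sqDist_sphereProj {x₀ x : Fin d → ℝ} (R : ℝ) (hx : 0 < sqDist x₀ x) :
    sqDist x₀ (sphereProj x₀ R x) = R ^ 2 := by
  rw [sphereProj, sqDist_add_smul, div_pow, Real.sq_sqrt hx.le]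
  field_simp

theorem sphereProj_of_mem {x₀ x : Fin d → ℝ} {R : ℝ} (hR : 0 < R) (hx : sqDist x₀ x = R ^ 2) :
    sphereProj x₀ R x = x := by
  rw [sphereProj, hx, Real.sqrt_sq hR.le, div_self hR.ne']
  simp

theorem contDiffOn_sphereProj (x₀ : Fin d → ℝ) (R : ℝ) :
    ContDiffOn ℝ 1 (sphereProj x₀ R) {x | 0 < sqDist x₀ x} := by
  unfold sphereProj
  refine contDiffOn_const.add (ContDiffOn.smul (contDiffOn_const.div
    (((contDiff_sqDist x₀).of_le le_top).contDiffOn.sqrt fun x hx => ne_of_gt hx) fun x hx => ?_)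
    (contDiffOn_id.sub contDiffOn_const))
  exact (Real.sqrt_pos.2 hx).ne'

theorem exists_fderiv_comp_sphereProj {x₀ x : Fin d → ℝ} {R : ℝ} (hx : 0 < sqDist x₀ x)
    {f : (Fin d → ℝ) → ℝ} (hf : DifferentiableAt ℝ f (sphereProj x₀ R x)) :
    ∃ β : ℝ, ∀ r, fderiv ℝ (fun y => f (sphereProj x₀ R y)) x (Pi.single r 1) =
      R / √(sqDist x₀ x) * fderiv ℝ f (sphereProj x₀ R x) (Pi.single r 1) +
        β * (x - x₀) r := by
  have hq : DifferentiableAt ℝ (sqDist x₀) x :=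
    (contDiff_sqDist x₀).differentiable (by simp) x
  have hφ : DifferentiableAt ℝ (fun t => R / √t) (sqDist x₀ x) :=
    (differentiableAt_const R).div (Real.hasDerivAt_sqrt hx.ne').differentiableAt
      (Real.sqrt_pos.2 hx).ne'
  have hρ := hφ.hasDerivAt.comp_hasFDerivAt x hq.hasFDerivAt
  have hid : HasFDerivAt (fun y : Fin d → ℝ => y - x₀) (ContinuousLinearMap.id ℝ _) x :=
    (hasFDerivAt_id x).sub_const x₀
  have hP := (hρ.smul hid).const_add x₀
  have hfP := hf.hasFDerivAt.comp x hP
  refine ⟨2 * deriv (fun t => R / √t) (sqDist x₀ x) *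
    fderiv ℝ f (sphereProj x₀ R x) (x - x₀), fun r => ?_⟩
  have heq : fderiv ℝ (fun y => f (sphereProj x₀ R y)) x = _ := hfP.fderiv
  rw [heq]
  simp only [ContinuousLinearMap.comp_apply, add_apply,
    smul_apply, ContinuousLinearMap.smulRight_apply, map_add, map_smul,
    ContinuousLinearMap.id_apply, fderiv_sqDist, smul_eq_mul, Function.comp_apply, Pi.sub_apply]
  ring

theorem continuous_det_updateCol (k₀ : Fin d) :
    Continuous fun p : Matrix (Fin d) (Fin d) ℝ × (Fin d → ℝ) => (p.1.updateCol k₀ p.2).det :=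
  (continuous_fst.matrix_updateCol k₀ continuous_snd).matrix_det

set_option maxHeartbeats 1000000 in
/-- Boundary estimate on a ball: the integral of `det(du, dF')` depends only on the boundary. -/
theorem abs_integral_jacobianDet_update_le {x₀ : Fin d → ℝ} {R : ℝ} (hR : 0 < R)
    {U : Set (Fin d → ℝ)} (hU : IsOpen U) (hBU : {x | sqDist x₀ x ≤ R ^ 2} ⊆ U)
    {F : Fin d → (Fin d → ℝ) → ℝ} (hF : ∀ k, ContDiffOn ℝ 2 (F k) U) (k₀ : Fin d) (N : ℕ)
    (hN : ∀ y : Fin d → ℝ, {x | sqDist x₀ x = R ^ 2 ∧ (∀ k ≠ k₀, F k x = y k) ∧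
      ((gradMatrix F x).updateCol k₀ (x - x₀)).det ≠ 0}.encard ≤ N)
    {u : (Fin d → ℝ) → ℝ} (hu : ContDiffOn ℝ 1 u U) {M : ℝ} (hM0 : 0 ≤ M)
    (hM : ∀ x, sqDist x₀ x = R ^ 2 → |u x| ≤ M) {η : Fin d → ℝ} (hη : ∀ k, 0 ≤ η k)
    (hsupp : ∀ x, sqDist x₀ x = R ^ 2 → u x ≠ 0 → ∀ k ≠ k₀, |F k x| ≤ η k) :
    |∫ x in {x | sqDist x₀ x ≤ R ^ 2}, jacobianDet (Function.update F k₀ u) x| ≤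
      N * M * (∫ t, |deriv Real.smoothTransition t|) *
        ∏ k ∈ Finset.univ.erase k₀, (2 * η k) := by
  classical
  set B := {x | sqDist x₀ x ≤ R ^ 2} with hB
  have hBc : IsCompact B := isCompact_sqDist_le x₀ R
  have hR2 : 0 < R ^ 2 := by positivity
  have hqc : Continuous (sqDist x₀) := (contDiff_sqDist x₀).continuous
  have hF1 : ∀ k, ContDiffOn ℝ 1 (F k) U := fun k => (hF k).of_le (by norm_num)
  have hFu : ∀ k, ContDiffOn ℝ 1 (Function.update F k₀ u k) U := contDiffOn_update hF1 hu
  set J := jacobianDet (Function.update F k₀ u) with hJ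
  have hJc : ContinuousOn J B := (continuousOn_jacobianDet hU hFu).mono hBU
  obtain ⟨CJ, hCJ⟩ := hBc.exists_bound_of_continuousOn hJc
  obtain ⟨CT, hCT0, hCT⟩ := exists_abs_deriv_smoothTransition_le
  set P := sphereProj x₀ R with hP
  set D : (Fin d → ℝ) → ℝ := fun x => ((gradMatrix F x).updateCol k₀ (x - x₀)).det with hD
  set D' : (Fin d → ℝ) → ℝ := fun x => ((gradMatrix F (P x)).updateCol k₀ (x - x₀)).det with hD'
  have hPU : ∀ x, 0 < sqDist x₀ x → P x ∈ U := fun x hx => hBU (sqDist_sphereProj R hx).le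
  have hPc : ContinuousOn P {x | 0 < sqDist x₀ x} := (contDiffOn_sphereProj x₀ R).continuousOn
  have hgc := continuousOn_gradMatrix hU hF1
  have hDc : ContinuousOn D U := (continuous_det_updateCol k₀).comp_continuousOn
    (hgc.prodMk (continuousOn_id.sub continuousOn_const))
  have hDc' : ContinuousOn D' {x | 0 < sqDist x₀ x} :=
    (continuous_det_updateCol k₀).comp_continuousOn
      ((hgc.comp hPc hPU).prodMk (continuousOn_id.sub continuousOn_const))
  have huP : ContinuousOn (fun x => u (P x)) {x | 0 < sqDist x₀ x} :=
    hu.continuousOn.comp hPc hPU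
  set A : ℝ → Set (Fin d → ℝ) := fun h => {x | sqDist x₀ x ≤ R ^ 2 ∧ R ^ 2 - h ≤ sqDist x₀ x}
    with hA
  have hAB : ∀ h, A h ⊆ B := fun h x hx => hx.1
  have hAc : ∀ h, IsCompact (A h) := fun h => hBc.of_isClosed_subset
    ((isClosed_le hqc continuous_const).inter (isClosed_le continuous_const hqc)) (hAB h)
  have hA0 : ∀ h, h < R ^ 2 → A h ⊆ {x | 0 < sqDist x₀ x} := fun h hh x hx => by
    have := hx.2; simp only [Set.mem_ofPred_eq]; linarith
  set V := d / R ^ 2 * volume.real B with hV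
  have hV0 : 0 ≤ V := by positivity
  have hvol : ∀ h, 0 < h → h < R ^ 2 → volume.real (A h) ≤ V * h := fun h h1 h2 =>
    volume_annulus_le x₀ hR h1 h2
  set Err : (Fin d → ℝ) → ℝ := fun x => |u x * D x| - |u (P x) * D' x| with hErr
  have hErrc : ContinuousOn Err (A (R ^ 2 / 2)) := by
    have h1 := hA0 (R ^ 2 / 2) (by linarith)
    have h2 : A (R ^ 2 / 2) ⊆ U := (hAB _).trans hBU
    exact (((hu.continuousOn.mono h2).mul (hDc.mono h2)).abs).sub
      (((huP.mono h1).mul (hDc'.mono h1)).abs)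
  have hsmall : ∀ ω > 0, ∃ h₀ > 0, h₀ ≤ R ^ 2 / 2 ∧ ∀ x ∈ A h₀, Err x ≤ ω := by
    intro ω hω
    have hKc : IsCompact (A (R ^ 2 / 2) ∩ Err ⁻¹' Set.Ici ω) :=
      (hAc _).of_isClosed_subset
        (hErrc.preimage_isClosed_of_isClosed (hAc _).isClosed isClosed_Ici) Set.inter_subset_left
    rcases (A (R ^ 2 / 2) ∩ Err ⁻¹' Set.Ici ω).eq_empty_or_nonempty with he | hne
    · refine ⟨R ^ 2 / 2, by positivity, le_rfl, fun x hx => ?_⟩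
      by_contra! hlt
      have : x ∈ A (R ^ 2 / 2) ∩ Err ⁻¹' Set.Ici ω := ⟨hx, hlt.le⟩
      rw [he] at this; exact this
    · obtain ⟨z, hz, hzmax⟩ := hKc.exists_isMaxOn hne hqc.continuousOn
      have hzlt : sqDist x₀ z < R ^ 2 := by
        refine lt_of_le_of_ne hz.1.1 fun heq => ?_
        have h0 : Err z = 0 := by
          simp only [hErr, hD, hD', hP, sphereProj_of_mem hR heq, sub_self]
        have : ω ≤ Err z := hz.2
        linarith
      have hz2 := hz.1.2
      refine ⟨(R ^ 2 - sqDist x₀ z) / 2, by linarith, by linarith, fun x hx => ?_⟩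
      by_contra! hlt
      have hx2 := hx.2
      have : sqDist x₀ x ≤ sqDist x₀ z :=
        hzmax (a := x) ⟨⟨hx.1, by linarith⟩, hlt.le⟩
      linarith
  set I := ∫ t, |deriv Real.smoothTransition t| with hI
  set Q := ∏ k ∈ Finset.univ.erase k₀, (2 * η k) with hQ
  -- the estimate at a fixed scale
  have main : ∀ ω > 0, ∀ h > 0, h ≤ R ^ 2 / 2 → (∀ x ∈ A h, Err x ≤ ω) →
      |∫ x in B, J x| ≤ CJ * (V * h) + 2 * CT * ω * V + N * M * I * Q := by
    intro ω hω h hh hhR hE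
    have hhR' : h < R ^ 2 := by linarith
    set arg : (Fin d → ℝ) → ℝ := fun x => (R ^ 2 - sqDist x₀ x) / h with harg
    have hargd : ContDiff ℝ 1 arg :=
      (contDiff_const.sub ((contDiff_sqDist x₀).of_le le_top)).div_const h
    set θ : (Fin d → ℝ) → ℝ := fun x => Real.smoothTransition (arg x) with hθ
    have hθd : ContDiff ℝ 1 θ := contDiff_smoothTransition.comp hargd
    have hjθ : ∀ x, jacobianDet (Function.update F k₀ θ) x =
        -(2 / h) * (deriv Real.smoothTransition (arg x) * D x) := by
      intro x
      have h1 := jacobianDet_update_comp (F := F) (k₀ := k₀) (x := x) (χ := Real.smoothTransition)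
        (g := arg) (contDiff_smoothTransition.differentiable one_ne_zero _)
        (hargd.differentiable one_ne_zero _)
      rw [hθ, h1, jacobianDet_update]
      have h2 : (fun r => fderiv ℝ arg x (Pi.single r 1)) = (-(2 / h)) • (x - x₀) := by
        ext r
        have hd : HasFDerivAt arg (h⁻¹ • (-fderiv ℝ (sqDist x₀) x)) x := by
          have := ((((contDiff_sqDist x₀).differentiable (by simp) x).hasFDerivAt.const_sub
            (R ^ 2)).const_mul h⁻¹)
          refine this.congr_of_eventuallyEq (Filter.Eventually.of_forall fun y => ?_)
          simp only [harg, div_eq_inv_mul]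
        rw [hd.fderiv]
        simp [fderiv_sqDist]
        ring
      rw [h2, Matrix.det_updateCol_smul]
      ring
    have hθ1 : ∀ x ∈ B, x ∉ A h → 1 < arg x := by
      intro x hx hxA
      have : sqDist x₀ x < R ^ 2 - h := by
        by_contra! hc; exact hxA ⟨hx, hc⟩
      rw [harg, lt_div_iff₀ hh]; linarith
    have hzero := integral_jacobianDet_update_eq_zero (k₀ := k₀) (v := fun x => u x * θ x)
      hU hBc hBU hF (hu.mul hθd.contDiffOn) (fun x hx => by
        have : arg x ≤ 0 := by
          have : R ^ 2 < sqDist x₀ x := not_le.1 hx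
          exact div_nonpos_of_nonpos_of_nonneg (by linarith) hh.le
        simp [hθ, Real.smoothTransition.zero_of_nonpos this])
    have hJi : IntegrableOn J B := hJc.integrableOn_compact hBc
    have hargc : Continuous arg := hargd.continuous
    have hTc : Continuous fun x => deriv Real.smoothTransition (arg x) :=
      continuous_deriv_smoothTransition.comp hargc
    have hθJi : IntegrableOn (fun x => θ x * J x) B :=
      (hθd.continuous.continuousOn.mul hJc).integrableOn_compact hBc
    have huDc : ContinuousOn (fun x => deriv Real.smoothTransition (arg x) * (u x * D x)) B :=
      hTc.continuousOn.mul ((hu.continuousOn.mono hBU).mul (hDc.mono hBU))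
    have huDi := huDc.integrableOn_compact (μ := volume) hBc
    have hθJ : ∫ x in B, θ x * J x =
        2 / h * ∫ x in B, deriv Real.smoothTransition (arg x) * (u x * D x) := by
      have hpt : ∀ x ∈ B, jacobianDet (Function.update F k₀ fun x => u x * θ x) x =
          θ x * J x - 2 / h * (deriv Real.smoothTransition (arg x) * (u x * D x)) := by
        intro x hx
        rw [jacobianDet_update_mul
          ((hu.contDiffAt (hU.mem_nhds (hBU hx))).differentiableAt one_ne_zero)
          (hθd.differentiable one_ne_zero x), hjθ]
        ring
      rw [setIntegral_congr_fun hBc.measurableSet hpt, integral_sub hθJi (huDi.const_mul _),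
        integral_const_mul] at hzero
      linarith
    have hAm : MeasurableSet (A h) := (hAc h).measurableSet
    have hAfin : volume (A h) ≠ ⊤ := (hAc h).measure_lt_top.ne
    -- the part where the cutoff is not yet one
    have hfirst : |∫ x in B, (1 - θ x) * J x| ≤ CJ * (V * h) := by
      rw [setIntegral_eq_of_subset_of_forall_sdiff_eq_zero hBc.measurableSet (hAB h)]
      · have hb := norm_setIntegral_le_of_norm_le_const (μ := volume) (s := A h)
          (f := fun x => (1 - θ x) * J x) (C := CJ) (hAc h).measure_lt_top (fun x hx => by
            rw [norm_mul]
            have h1 : ‖1 - θ x‖ ≤ 1 := by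
              rw [Real.norm_eq_abs, abs_le]
              have := Real.smoothTransition.nonneg (arg x)
              have := Real.smoothTransition.le_one (arg x)
              constructor <;> simp only [hθ] <;> linarith
            calc ‖1 - θ x‖ * ‖J x‖ ≤ 1 * CJ := by
                  gcongr; exact hCJ x (hAB h hx)
              _ = CJ := one_mul _)
        refine hb.trans ?_
        rcases (A h).eq_empty_or_nonempty with he | ⟨z, hz⟩
        · have : (0:ℝ) ≤ CJ := (norm_nonneg _).trans (hCJ x₀ (by
            simp only [hB, Set.mem_ofPred_eq, sqDist]; simp; positivity))
          simp only [he, measureReal_empty, mul_zero]; positivity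
        · have : (0:ℝ) ≤ CJ := (norm_nonneg _).trans (hCJ z (hAB h hz))
          exact mul_le_mul_of_nonneg_left (hvol h hh hhR') this
      · intro x hx
        have : θ x = 1 := Real.smoothTransition.one_of_one_le (hθ1 x hx.1 hx.2).le
        simp [this]
    -- the area inequality after projecting to the sphere
    set Ψ := Function.update (fun k x => F k (P x)) k₀ (sqDist x₀) with hΨ
    have hWo : IsOpen {x | 0 < sqDist x₀ x} := isOpen_lt continuous_const hqc
    have hΨd : ∀ k, ContDiffOn ℝ 1 (Ψ k) {x | 0 < sqDist x₀ x} :=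
      contDiffOn_update (fun k => (hF1 k).comp (contDiffOn_sphereProj x₀ R) hPU)
        ((contDiff_sqDist x₀).of_le le_top).contDiffOn
    have hdetΨ : ∀ x ∈ A h, ∃ γ : ℝ, 2 ≤ |γ| ∧ jacobianDet Ψ x = γ * D' x := by
      intro x hx
      have hx0 : 0 < sqDist x₀ x := hA0 h hhR' hx
      have hfd : ∀ k, DifferentiableAt ℝ (F k) (sphereProj x₀ R x) := fun k =>
        ((hF1 k).contDiffAt (hU.mem_nhds (hPU x hx0))).differentiableAt one_ne_zero
      choose β hβ using fun k => exists_fderiv_comp_sphereProj hx0 (hfd k)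
      refine exists_det_eq_mul_det_updateCol (α := R / √(sqDist x₀ x)) (β := β) ?_ ?_ ?_
      · rw [one_le_div (Real.sqrt_pos.2 hx0)]
        exact (Real.sqrt_le_sqrt hx.1).trans_eq (Real.sqrt_sq hR.le)
      · intro r
        simp [hΨ, fderiv_sqDist]
      · intro k hk r
        simp only [hΨ, Matrix.of_apply, Function.update_of_ne hk]
        exact hβ k r
    have hdet : ∀ x ∈ A h, 2 * |D' x| ≤ |jacobianDet Ψ x| := by
      intro x hx
      obtain ⟨γ, hγ, he⟩ := hdetΨ x hx
      rw [he, abs_mul]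
      gcongr
    have hcount : ∀ y : Fin d → ℝ,
        {x ∈ A h | (∀ k, Ψ k x = y k) ∧ jacobianDet Ψ x ≠ 0}.encard ≤ N := by
      intro y
      refine (Set.encard_le_encard_of_injOn (f := P) ?_ ?_).trans (hN y)
      · rintro x ⟨hx, hy, hne⟩
        have hx0 : 0 < sqDist x₀ x := hA0 h hhR' hx
        refine ⟨sqDist_sphereProj R hx0, fun k hk => by simpa [hΨ, hk] using hy k, ?_⟩
        intro h0
        have hx0' : R / √(sqDist x₀ x) ≠ 0 := (div_pos hR (Real.sqrt_pos.2 hx0)).ne'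
        have hPx : P x - x₀ = (R / √(sqDist x₀ x)) • (x - x₀) := by
          simp [hP, sphereProj]
        rw [hPx, Matrix.det_updateCol_smul] at h0
        have hD0 : D' x = 0 := (mul_eq_zero.1 h0).resolve_left hx0'
        apply hne
        obtain ⟨γ, -, he⟩ := hdetΨ x hx
        rw [he, hD0, mul_zero]
      · rintro x ⟨hx, hy, -⟩ x' ⟨hx', hy', -⟩ hPP
        have h1 : sqDist x₀ x = y k₀ := by simpa [hΨ] using hy k₀
        have h2 : sqDist x₀ x' = y k₀ := by simpa [hΨ] using hy' k₀
        have hx0 : 0 < sqDist x₀ x := hA0 h hhR' hx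
        have hx0' : R / √(y k₀) ≠ 0 := (div_pos hR (Real.sqrt_pos.2 (h1 ▸ hx0))).ne'
        simp only [hP, sphereProj, h1, h2, add_right_inj] at hPP
        have := smul_right_injective _ hx0' hPP
        exact sub_left_injective this
    have hgc' : Continuous fun t => h⁻¹ * |deriv Real.smoothTransition ((R ^ 2 - t) / h)| :=
      continuous_const.mul (continuous_deriv_smoothTransition.comp (by fun_prop)).abs
    have hgint : Integrable fun t => h⁻¹ * |deriv Real.smoothTransition ((R ^ 2 - t) / h)| :=
      (((integrable_deriv_smoothTransition.comp_div hh.ne').comp_sub_left (R ^ 2)).abs).const_mul _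
    have hgI : ∫ t, h⁻¹ * |deriv Real.smoothTransition ((R ^ 2 - t) / h)| = I := by
      rw [integral_const_mul,
        integral_sub_left_eq_self (fun t => |deriv Real.smoothTransition (t / h)|) volume (R ^ 2),
        Measure.integral_comp_div (fun t => |deriv Real.smoothTransition t|) h, abs_of_pos hh,
        smul_eq_mul, inv_mul_cancel_left₀ hh.ne']
    have harea := setIntegral_abs_jacobianDet_mul_le (hAc h) (fun x hx k =>
        ((hΨd k).contDiffAt (hWo.mem_nhds (hA0 h hhR' hx))).differentiableAt one_ne_zero)
      ((continuousOn_jacobianDet hWo hΨd).mono (hA0 h hhR')) N hcount k₀ hgc'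
      (fun t => by positivity) hgint hη
    rw [hgI] at harea
    have hΨk₀ : Ψ k₀ = sqDist x₀ := by simp [hΨ]
    rw [hΨk₀] at harea
    set E := A h ∩ {x | ∀ k ≠ k₀, |Ψ k x| ≤ η k} with hEdef
    have hthird : ∫ x in A h, |deriv Real.smoothTransition (arg x)| * |u (P x) * D' x| ≤
        h / 2 * (N * M * I * Q) := by
      have hEm : MeasurableSet E :=
        (isClosed_inter_abs_le (hAc h).isClosed
          (fun k => (hΨd k).continuousOn.mono (hA0 h hhR')) k₀ η).measurableSet
      have hvan : ∀ x ∈ A h \ E,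
          |deriv Real.smoothTransition (arg x)| * |u (P x) * D' x| = 0 := by
        intro x hx
        have hx0 : 0 < sqDist x₀ x := hA0 h hhR' hx.1
        have : u (P x) = 0 := by
          by_contra hne
          refine hx.2 ⟨hx.1, fun k hk => ?_⟩
          simpa [hΨ, hk] using hsupp (P x) (sqDist_sphereProj R hx0) hne k hk
        simp [this]
      rw [setIntegral_eq_of_subset_of_forall_sdiff_eq_zero hAm Set.inter_subset_left hvan]
      have hle : ∫ x in E, |deriv Real.smoothTransition (arg x)| * |u (P x) * D' x| ≤
          ∫ x in E, h / 2 * M * (|jacobianDet Ψ x| *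
            (h⁻¹ * |deriv Real.smoothTransition ((R ^ 2 - sqDist x₀ x) / h)|)) := by
        refine setIntegral_mono_on ?_ ?_ hEm fun x hx => ?_
        · refine IntegrableOn.mono_set (t := A h) ?_ Set.inter_subset_left
          refine ContinuousOn.integrableOn_compact (hAc h) ?_
          exact hTc.continuousOn.abs.mul
            (((huP.mono (hA0 h hhR')).mul (hDc'.mono (hA0 h hhR'))).abs)
        · refine IntegrableOn.mono_set (t := A h) ?_ Set.inter_subset_left
          refine ContinuousOn.integrableOn_compact (hAc h) ?_
          refine continuousOn_const.mul (ContinuousOn.mul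
            ((continuousOn_jacobianDet hWo hΨd).mono (hA0 h hhR')).abs ?_)
          exact (hgc'.comp hqc).continuousOn
        · have hx0 : 0 < sqDist x₀ x := hA0 h hhR' hx.1
          have h1 := hdet x hx.1
          have h2 := hM (P x) (sqDist_sphereProj R hx0)
          rw [abs_mul]
          have e : h / 2 * M * (|jacobianDet Ψ x| *
            (h⁻¹ * |deriv Real.smoothTransition ((R ^ 2 - sqDist x₀ x) / h)|)) =
            |deriv Real.smoothTransition (arg x)| * (M * (|jacobianDet Ψ x| / 2)) := by
            simp only [harg]; field_simp
          rw [e]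
          gcongr
          linarith
      refine hle.trans ?_
      rw [integral_const_mul]
      calc _ ≤ h / 2 * M * (N * I * Q) := by gcongr
        _ = _ := by ring
    have hsecond : |∫ x in B, deriv Real.smoothTransition (arg x) * (u x * D x)| ≤
        CT * ω * (V * h) + h / 2 * (N * M * I * Q) := by
      have hred := setIntegral_eq_of_subset_of_forall_sdiff_eq_zero (μ := volume)
        (f := fun x => deriv Real.smoothTransition (arg x) * (u x * D x)) hBc.measurableSet (hAB h)
        (fun x hx => by rw [deriv_smoothTransition_eq_zero (Or.inl (hθ1 x hx.1 hx.2)), zero_mul])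
      rw [hred]
      have hi : IntegrableOn (fun x => |deriv Real.smoothTransition (arg x)| *
          |u (P x) * D' x|) (A h) :=
        ContinuousOn.integrableOn_compact (hAc h) (hTc.continuousOn.abs.mul
            (((huP.mono (hA0 h hhR')).mul (hDc'.mono (hA0 h hhR'))).abs))
      calc |∫ x in A h, deriv Real.smoothTransition (arg x) * (u x * D x)|
          ≤ ∫ x in A h, |deriv Real.smoothTransition (arg x) * (u x * D x)| :=
            abs_integral_le_integral_abs
        _ ≤ ∫ x in A h, (CT * ω + |deriv Real.smoothTransition (arg x)| * |u (P x) * D' x|) := by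
            refine setIntegral_mono_on (huDi.mono_set (hAB h)).abs
              ((integrableOn_const hAfin).add hi) hAm fun x hx => ?_
            have h1 := hE x hx
            simp only [hErr] at h1
            rw [abs_mul]
            nlinarith [hCT (arg x), abs_nonneg (deriv Real.smoothTransition (arg x)),
              mul_le_mul_of_nonneg_right (hCT (arg x)) hω.le,
              mul_le_mul_of_nonneg_left h1 (abs_nonneg (deriv Real.smoothTransition (arg x)))]
        _ ≤ _ := by
            have hc : Integrable (fun _ : Fin d → ℝ => CT * ω) (volume.restrict (A h)) :=
              integrableOn_const hAfin
            rw [integral_add hc hi, setIntegral_const, smul_eq_mul, mul_comm]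
            gcongr
            exact hvol h hh hhR'
    have hsplit : ∫ x in B, J x = (∫ x in B, (1 - θ x) * J x) + ∫ x in B, θ x * J x := by
      rw [← integral_add _ hθJi]
      · congr 1; ext x; ring
      · have := hJi.sub hθJi
        refine this.congr (Filter.Eventually.of_forall fun x => ?_)
        simp; ring
    rw [hsplit, hθJ]
    refine (abs_add_le _ _).trans ?_
    rw [abs_mul, abs_of_pos (by positivity : 0 < 2 / h)]
    have := mul_le_mul_of_nonneg_left hsecond (by positivity : 0 ≤ 2 / h)
    have e : 2 / h * (CT * ω * (V * h) + h / 2 * (N * M * I * Q)) =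
        2 * CT * ω * V + N * M * I * Q := by field_simp
    rw [e] at this
    linarith
  have hCJ0 : 0 ≤ CJ := (norm_nonneg _).trans (hCJ x₀ (by
    simp only [hB, Set.mem_ofPred_eq, sqDist]; simp; positivity))
  refine le_of_forall_pos_le_add fun e he => ?_
  set ω := e / 2 / (2 * CT * V + 1) with hω
  have hω0 : 0 < ω := by positivity
  obtain ⟨h₀, hh₀, hh₀R, hEh₀⟩ := hsmall ω hω0
  set h := min h₀ (e / 2 / (CJ * V + 1)) with hh
  have hh0 : 0 < h := lt_min hh₀ (by positivity)
  have hle : h ≤ h₀ := min_le_left _ _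
  have := main ω hω0 h hh0 (hle.trans hh₀R) fun x hx => hEh₀ x ⟨hx.1, by have := hx.2; linarith⟩
  have h1 : CJ * (V * h) ≤ e / 2 := by
    have h2 : h ≤ e / 2 / (CJ * V + 1) := min_le_right _ _
    rw [le_div_iff₀ (by positivity)] at h2
    nlinarith
  have h3 : 2 * CT * ω * V ≤ e / 2 := by
    have h2 : ω ≤ e / 2 / (2 * CT * V + 1) := le_rfl
    rw [le_div_iff₀ (by positivity)] at h2
    nlinarith
  linarith

end Ball

section Trees
variable {d M₀ : ℕ}

namespace DTree

theorem deriv_node (π : Fin M₀ → (Fin d → ℝ) → ℝ) (H : Fin d → DTree d M₀) :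
    (node H).deriv π = jacobianDet fun k => (H k).deriv π := rfl

theorem depth_node (H : Fin d → DTree d M₀) :
    (node H).depth = (Finset.univ.sup fun k => (H k).depth) + 1 := rfl

theorem depth_node_le_succ {H : Fin d → DTree d M₀} {k : ℕ} :
    (node H).depth ≤ k + 1 ↔ ∀ i, (H i).depth ≤ k := by
  rw [depth_node, Nat.add_le_add_iff_right, Finset.sup_le_iff]
  simp

theorem nontrivial_node (H : Fin d → DTree d M₀) : (node H).Nontrivial := by
  intro i h; cases h

theorem analyticOnNhd_deriv {π : Fin M₀ → (Fin d → ℝ) → ℝ} {U : Set (Fin d → ℝ)}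
    (hπ : ∀ j, AnalyticOnNhd ℝ (π j) U) (T : DTree d M₀) : AnalyticOnNhd ℝ (T.deriv π) U := by
  induction T with
  | leaf i => exact hπ i
  | node H ih =>
    have hent : ∀ r k, AnalyticOnNhd ℝ
        (fun x => fderiv ℝ ((H k).deriv π) x (Pi.single r 1)) U := fun r k =>
      (ContinuousLinearMap.apply ℝ ℝ (Pi.single r (1 : ℝ) : Fin d → ℝ)).comp_analyticOnNhd
        (ih k).fderiv
    have : (node H).deriv π = fun x => ∑ σ : Equiv.Perm (Fin d), ((Equiv.Perm.sign σ : ℤ) : ℝ) *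
        ∏ i, fderiv ℝ ((H i).deriv π) x (Pi.single (σ i) 1) := by
      ext x
      rw [deriv_node, jacobianDet, Matrix.det_apply']
      rfl
    rw [this]
    refine Finset.analyticOnNhd_fun_sum _ fun σ _ => analyticOnNhd_const.mul ?_
    exact Finset.analyticOnNhd_fun_prod _ fun i _ => hent _ _

end DTree

/-- The standing hypotheses on the system `π` over the ball of center `x₀` and radius `R`. -/
structure TreeSystem (K N : ℕ) (x₀ : Fin d → ℝ) (R : ℝ) (U : Set (Fin d → ℝ))
    (π : Fin M₀ → (Fin d → ℝ) → ℝ) : Prop where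
  pos : 0 < R
  isOpen : IsOpen U
  subset : {x | sqDist x₀ x ≤ R ^ 2} ⊆ U
  contDiffOn : ∀ T : DTree d M₀, ContDiffOn ℝ 2 (T.deriv π) U
  ball : ∀ H : Fin d → DTree d M₀, (∀ k, (H k).depth ≤ K) → ∀ y : Fin d → ℝ,
    {x ∈ {x | sqDist x₀ x ≤ R ^ 2} | (∀ k, (H k).deriv π x = y k) ∧
      jacobianDet (fun k => (H k).deriv π) x ≠ 0}.encard ≤ N
  sphere : ∀ H : Fin d → DTree d M₀, (∀ k, (H k).depth ≤ K) → ∀ k₀, ∀ y : Fin d → ℝ,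
    {x | sqDist x₀ x = R ^ 2 ∧ (∀ k ≠ k₀, (H k).deriv π x = y k) ∧
      ((gradMatrix (fun k => (H k).deriv π) x).updateCol k₀ (x - x₀)).det ≠ 0}.encard ≤ N

theorem TreeSystem.mk_of_strongMult {K N : ℕ} {x₀ : Fin d → ℝ} {R : ℝ} (hR : 0 < R)
    {U : Set (Fin d → ℝ)} (hU : IsOpen U) (hBU : {x | sqDist x₀ x ≤ R ^ 2} ⊆ U)
    {π : Fin M₀ → (Fin d → ℝ) → ℝ} (hπ : ∀ j, AnalyticOnNhd ℝ (π j) U)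
    (h : ∀ G : DTree d M₀, G.Nontrivial → G.depth ≤ K + 1 →
      G.StrongMult {x | sqDist x₀ x ≤ R ^ 2} π N ∧
      G.StrongMultSphere x₀ {x | sqDist x₀ x = R ^ 2} π N) :
    TreeSystem K N x₀ R U π where
  pos := hR
  isOpen := hU
  subset := hBU
  contDiffOn T := (DTree.analyticOnNhd_deriv hπ T).contDiffOn hU.uniqueDiffOn
  ball H hH y := (h (.node H) (DTree.nontrivial_node H) (DTree.depth_node_le_succ.2 hH)).1.2 y
  sphere H hH k₀ y := by
    obtain ⟨n, rfl⟩ : ∃ n, d = n + 1 := ⟨d - 1, by have := k₀.pos; omega⟩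
    have h1 := (h (.node H) (DTree.nontrivial_node H) (DTree.depth_node_le_succ.2 hH)).2.2
      k₀.succAbove fun k => y (k₀.succAbove k)
    refine (Set.encard_le_encard ?_).trans h1
    rintro x ⟨hx, hy, hdet⟩
    refine ⟨hx, fun k => hy _ (Fin.succAbove_ne _ _), ?_⟩
    have hli := Matrix.linearIndependent_cols_of_det_ne_zero hdet
    have hinj : Function.Injective (Sum.elim (fun _ : Unit => k₀) k₀.succAbove) := by
      rintro (a | a) (b | b) hab
      · rfl
      · exact absurd hab.symm (Fin.succAbove_ne _ _)
      · exact absurd hab (Fin.succAbove_ne _ _)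
      · simpa using hab
    have := hli.comp _ hinj
    have he : ((gradMatrix (fun k => (H k).deriv π) x).updateCol k₀ (x - x₀)).col ∘
        Sum.elim (fun _ : Unit => k₀) k₀.succAbove =
        Sum.elim (fun _ : Unit => fun i => x i - x₀ i) (fun k : Fin n => fun i =>
          fderiv ℝ ((H (k₀.succAbove k)).deriv π) x (Pi.single i 1)) := by
      funext s
      rcases s with a | a <;> ext i
      · change (gradMatrix _ x).updateCol k₀ (x - x₀) i k₀ = _
        simp
      · change (gradMatrix _ x).updateCol k₀ (x - x₀) i (k₀.succAbove a) = _
        rw [Matrix.updateCol_ne (Fin.succAbove_ne _ _)]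
        rfl
    rw [he] at this
    exact this

end Trees

/-- A `C¹` function of a real variable, bounded by `1` and of total variation at most `v`. -/
structure IsCutoff (v : ℝ) (χ : ℝ → ℝ) : Prop where
  contDiff : ContDiff ℝ 1 χ
  abs_le_one : ∀ t, |χ t| ≤ 1
  integrable_deriv : Integrable (deriv χ)
  integral_abs_deriv_le : ∫ t, |deriv χ t| ≤ v

namespace IsCutoff
variable {v : ℝ} {χ : ℝ → ℝ}

theorem mono {v' : ℝ} (h : IsCutoff v χ) (hv : v ≤ v') : IsCutoff v' χ :=
  ⟨h.1, h.2, h.3, h.4.trans hv⟩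

theorem comp_affine (h : IsCutoff v χ) {α : ℝ} (hα : α ≠ 0) (β : ℝ) :
    IsCutoff v fun s => χ (α * s + β) := by
  have hd : deriv (fun s => χ (α * s + β)) = fun s => deriv χ (α * s + β) * α := by
    ext s
    have h1 : HasDerivAt (fun s : ℝ => α * s + β) α s := by
      simpa using ((hasDerivAt_id s).const_mul α).add_const β
    exact (((h.contDiff.differentiable one_ne_zero) _).hasDerivAt.comp s h1).deriv
  refine ⟨h.contDiff.comp (by fun_prop), fun t => h.abs_le_one _, ?_, ?_⟩
  · rw [hd]
    exact (((h.integrable_deriv.comp_add_right β).comp_mul_left' hα).mul_const α)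
  · refine le_trans (le_of_eq ?_) h.integral_abs_deriv_le
    rw [hd]
    simp only [abs_mul]
    rw [integral_mul_const,
      Measure.integral_comp_mul_left (fun s => |deriv χ (s + β)|) α,
      integral_add_right_eq_self (fun s => |deriv χ s|) β, abs_inv, smul_eq_mul, mul_comm,
      mul_inv_cancel_left₀ (abs_ne_zero.2 hα)]

theorem comp_div (h : IsCutoff v χ) {δ : ℝ} (hδ : δ ≠ 0) : IsCutoff v fun s => χ (s / δ) := by
  simpa [div_eq_inv_mul] using h.comp_affine (inv_ne_zero hδ) 0

end IsCutoff

/-- A smooth cutoff equal to `0` for `|u| ≤ 1/2` and to `1` for `|u| ≥ 1`. -/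
noncomputable def farCut (u : ℝ) : ℝ := Real.smoothTransition (4 * u ^ 2 - 1)

/-- The complementary cutoff, equal to `1` for `|u| ≤ 1/2` and to `0` for `|u| ≥ 1`. -/
noncomputable def nearCut (u : ℝ) : ℝ := 1 - farCut u

/-- The function `1 / (2u)`, cut off away from the origin. -/
noncomputable def farInv (u : ℝ) : ℝ := farCut u / (2 * u)

theorem farCut_nonneg (u : ℝ) : 0 ≤ farCut u := Real.smoothTransition.nonneg _
theorem farCut_le_one (u : ℝ) : farCut u ≤ 1 := Real.smoothTransition.le_one _

theorem farCut_of_le {u : ℝ} (h : |u| ≤ 1 / 2) : farCut u = 0 := by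
  refine Real.smoothTransition.zero_of_nonpos ?_
  have : u ^ 2 ≤ (1 / 2) ^ 2 := by
    rw [← sq_abs]; exact pow_le_pow_left₀ (abs_nonneg _) h 2
  linarith

theorem farCut_of_one_le {u : ℝ} (h : 1 ≤ |u|) : farCut u = 1 := by
  refine Real.smoothTransition.one_of_one_le ?_
  have : 1 ≤ u ^ 2 := by
    rw [← sq_abs]; exact one_le_pow₀ h
  linarith

theorem farCut_zero : farCut 0 = 0 := farCut_of_le (by norm_num)

theorem farCut_le (u : ℝ) : farCut u ≤ 2 * |u| := by
  by_cases h : |u| ≤ 1 / 2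
  · rw [farCut_of_le h]; positivity
  · linarith [farCut_le_one u]

theorem farCut_eq_mul_farInv (u : ℝ) : farCut u = 2 * u * farInv u := by
  by_cases h : u = 0
  · simp [h, farCut_zero]
  · rw [farInv]; field_simp

theorem abs_farInv_le_one (u : ℝ) : |farInv u| ≤ 1 := by
  rw [farInv, abs_div, abs_of_nonneg (farCut_nonneg u), abs_mul, abs_two]
  exact div_le_one_of_le₀ (farCut_le u) (by positivity)

theorem contDiff_farCut : ContDiff ℝ 1 farCut :=
  contDiff_smoothTransition.comp (by fun_prop)

theorem contDiff_farInv : ContDiff ℝ 1 farInv := by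
  refine contDiff_iff_contDiffAt.2 fun u => ?_
  by_cases h : u = 0
  · have : farInv =ᶠ[nhds u] fun _ => 0 := by
      have hu : ∀ᶠ s in nhds u, |s| < 1 / 2 :=
        continuous_abs.continuousAt.eventually_lt continuousAt_const (by simp [h])
      filter_upwards [hu] with s hs
      rw [farInv, farCut_of_le hs.le, zero_div]
    exact contDiffAt_const.congr_of_eventuallyEq this
  · exact contDiff_farCut.contDiffAt.div (by fun_prop) (by simpa using h)

theorem eventually_one_le_abs {u : ℝ} (hu : 1 < |u|) : ∀ᶠ s in nhds u, 1 ≤ |s| :=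
  (continuousAt_const.eventually_lt continuous_abs.continuousAt hu).mono fun _ h => h.le

theorem integrable_deriv_farCut : Integrable (deriv farCut) := by
  refine integrable_of_abs_le_inv_sq (contDiff_farCut.continuous_deriv le_rfl) fun u hu => ?_
  have : farCut =ᶠ[nhds u] fun _ => 1 :=
    (eventually_one_le_abs hu).mono fun s hs => farCut_of_one_le hs
  rw [this.deriv_eq]
  simp only [deriv_const, abs_zero]
  positivity

theorem integrable_deriv_farInv : Integrable (deriv farInv) := by
  refine integrable_of_abs_le_inv_sq (contDiff_farInv.continuous_deriv le_rfl) fun u hu => ?_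
  have : farInv =ᶠ[nhds u] fun s => s⁻¹ / 2 := (eventually_one_le_abs hu).mono fun s hs => by
    rw [farInv, farCut_of_one_le hs, one_div, mul_inv]; ring
  rw [this.deriv_eq]
  simp only [deriv_div_const, deriv_inv]
  rw [abs_div, abs_neg, abs_inv, abs_two, abs_of_nonneg (sq_nonneg u), one_div]
  have : 0 ≤ (u ^ 2)⁻¹ := by positivity
  linarith

/-- A common bound for the total variations of the cutoffs in use. -/
noncomputable def cutoffVariation : ℝ :=
  (∫ t, |deriv Real.smoothTransition t|) + (∫ t, |deriv farCut t|) + ∫ t, |deriv farInv t|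

theorem integral_abs_deriv_nonneg (χ : ℝ → ℝ) : 0 ≤ ∫ t, |deriv χ t| :=
  integral_nonneg fun _ => abs_nonneg _

theorem cutoffVariation_nonneg : 0 ≤ cutoffVariation :=
  add_nonneg (add_nonneg (integral_abs_deriv_nonneg _) (integral_abs_deriv_nonneg _))
    (integral_abs_deriv_nonneg _)

theorem isCutoff_smoothTransition : IsCutoff cutoffVariation Real.smoothTransition where
  contDiff := contDiff_smoothTransition
  abs_le_one t := by
    rw [abs_of_nonneg (Real.smoothTransition.nonneg t)]; exact Real.smoothTransition.le_one t
  integrable_deriv := integrable_deriv_smoothTransition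
  integral_abs_deriv_le := by
    unfold cutoffVariation
    linarith [integral_abs_deriv_nonneg farCut, integral_abs_deriv_nonneg farInv]

theorem isCutoff_farCut : IsCutoff cutoffVariation farCut where
  contDiff := contDiff_farCut
  abs_le_one t := by
    rw [abs_of_nonneg (farCut_nonneg t)]; exact farCut_le_one t
  integrable_deriv := integrable_deriv_farCut
  integral_abs_deriv_le := by
    unfold cutoffVariation
    linarith [integral_abs_deriv_nonneg Real.smoothTransition, integral_abs_deriv_nonneg farInv]

theorem isCutoff_farInv : IsCutoff cutoffVariation farInv where
  contDiff := contDiff_farInv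
  abs_le_one := abs_farInv_le_one
  integrable_deriv := integrable_deriv_farInv
  integral_abs_deriv_le := by
    unfold cutoffVariation
    linarith [integral_abs_deriv_nonneg Real.smoothTransition, integral_abs_deriv_nonneg farCut]

theorem nearCut_of_one_le {u : ℝ} (h : 1 ≤ |u|) : nearCut u = 0 := by
  rw [nearCut, farCut_of_one_le h, sub_self]

theorem nearCut_of_le {u : ℝ} (h : |u| ≤ 1 / 2) : nearCut u = 1 := by
  rw [nearCut, farCut_of_le h, sub_zero]

theorem nearCut_nonneg (u : ℝ) : 0 ≤ nearCut u := sub_nonneg.2 (farCut_le_one u)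

theorem nearCut_le_one (u : ℝ) : nearCut u ≤ 1 := by
  rw [nearCut]; linarith [farCut_nonneg u]

theorem isCutoff_nearCut : IsCutoff cutoffVariation nearCut := by
  have hd : deriv nearCut = fun t => -deriv farCut t := by
    ext t; exact deriv_const_sub (f := farCut) 1
  refine ⟨contDiff_const.sub contDiff_farCut, fun t => ?_, ?_, ?_⟩
  · rw [abs_of_nonneg (nearCut_nonneg t)]; exact nearCut_le_one t
  · rw [hd]; exact isCutoff_farCut.integrable_deriv.neg
  · rw [hd]; simpa only [abs_neg] using isCutoff_farCut.integral_abs_deriv_le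

theorem integrable_nearCut : Integrable nearCut := by
  refine integrable_of_abs_le_inv_sq isCutoff_nearCut.contDiff.continuous fun u hu => ?_
  rw [nearCut_of_one_le hu.le, abs_zero]; positivity

theorem integral_nearCut_le : ∫ t, nearCut t ≤ 2 := by
  have h1 : ∫ t, nearCut t ≤ ∫ t, (Set.Icc (-1 : ℝ) 1).indicator 1 t := by
    refine integral_mono integrable_nearCut
      ((integrable_indicator_iff measurableSet_Icc).2 (by simp [Pi.one_def])) fun t => ?_
    by_cases ht : t ∈ Set.Icc (-1 : ℝ) 1
    · simpa [ht] using nearCut_le_one t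
    · rw [nearCut_of_one_le]
      · exact Set.indicator_nonneg (fun _ _ => zero_le_one) _
      · by_contra! h
        exact ht ⟨(abs_lt.1 h).1.le, (abs_lt.1 h).2.le⟩
  rw [integral_indicator_one measurableSet_Icc, Real.volume_real_Icc_of_le (by norm_num)] at h1
  linarith

section Trees
variable {d M₀ : ℕ}

/-- An amplitude on the ball: a function bounded by `1` whose variation along the fibres of any
`d - 1` of the derived functions of depth at most `K` is controlled by `V`. -/
structure IsAmplitude (K : ℕ) (x₀ : Fin d → ℝ) (R : ℝ) (U : Set (Fin d → ℝ))
    (π : Fin M₀ → (Fin d → ℝ) → ℝ) (V : ℝ) (a : (Fin d → ℝ) → ℝ) : Prop where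
  nonneg : 0 ≤ V
  contDiffOn : ContDiffOn ℝ 1 a U
  abs_le_one : ∀ x, |a x| ≤ 1
  integral_le : ∀ H : Fin d → DTree d M₀, (∀ k, (H k).depth ≤ K) → ∀ k₀, ∀ η : Fin d → ℝ,
    (∀ k, 0 ≤ η k) →
    ∫ x in {x | sqDist x₀ x ≤ R ^ 2} ∩ {x | ∀ k ≠ k₀, |(H k).deriv π x| ≤ η k},
      |jacobianDet (Function.update (fun k => (H k).deriv π) k₀ a) x| ≤
        V * ∏ k ∈ Finset.univ.erase k₀, (2 * η k)

namespace IsAmplitude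
variable {K N : ℕ} {x₀ : Fin d → ℝ} {R : ℝ} {U : Set (Fin d → ℝ)}
  {π : Fin M₀ → (Fin d → ℝ) → ℝ} {V V' : ℝ} {a a' : (Fin d → ℝ) → ℝ}

theorem mono (h : IsAmplitude K x₀ R U π V a) (hV : V ≤ V') : IsAmplitude K x₀ R U π V' a where
  nonneg := h.nonneg.trans hV
  contDiffOn := h.contDiffOn
  abs_le_one := h.abs_le_one
  integral_le H hH k₀ η hη := (h.integral_le H hH k₀ η hη).trans
    (mul_le_mul_of_nonneg_right hV (Finset.prod_nonneg fun k _ => by linarith [hη k]))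

theorem one : IsAmplitude K x₀ R U π 0 fun _ => 1 where
  nonneg := le_rfl
  contDiffOn := contDiffOn_const
  abs_le_one _ := by simp
  integral_le H hH k₀ η hη := by
    have : ∀ x, jacobianDet (Function.update (fun k => (H k).deriv π) k₀ fun _ => 1) x = 0 :=
      fun x => jacobianDet_update_eq_zero (by simp)
    simp [this]

end IsAmplitude

namespace TreeSystem
variable {K N : ℕ} {x₀ : Fin d → ℝ} {R : ℝ} {U : Set (Fin d → ℝ)}
  {π : Fin M₀ → (Fin d → ℝ) → ℝ} {V V' : ℝ} {a a' : (Fin d → ℝ) → ℝ}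

theorem contDiffOn_one (hS : TreeSystem K N x₀ R U π) (T : DTree d M₀) :
    ContDiffOn ℝ 1 (T.deriv π) U := (hS.contDiffOn T).of_le (by norm_num)

theorem continuousOn_jacobianDet_update (hS : TreeSystem K N x₀ R U π) (H : Fin d → DTree d M₀)
    (k₀ : Fin d) (ha : ContDiffOn ℝ 1 a U) : ContinuousOn
      (jacobianDet (Function.update (fun k => (H k).deriv π) k₀ a)) {x | sqDist x₀ x ≤ R ^ 2} :=
  (continuousOn_jacobianDet hS.isOpen
    (contDiffOn_update (fun k => hS.contDiffOn_one (H k)) ha)).mono hS.subset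

theorem isClosed_inter (hS : TreeSystem K N x₀ R U π) (H : Fin d → DTree d M₀)
    (k₀ : Fin d) (η : Fin d → ℝ) : IsClosed
      ({x | sqDist x₀ x ≤ R ^ 2} ∩ {x | ∀ k ≠ k₀, |(H k).deriv π x| ≤ η k}) :=
  isClosed_inter_abs_le (isCompact_sqDist_le x₀ R).isClosed
    (fun k => (hS.contDiffOn (H k)).continuousOn.mono hS.subset) k₀ η

theorem isAmplitude_mul (hS : TreeSystem K N x₀ R U π) (h : IsAmplitude K x₀ R U π V a)
    (h' : IsAmplitude K x₀ R U π V' a') :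
    IsAmplitude K x₀ R U π (V + V') fun x => a x * a' x where
  nonneg := add_nonneg h.nonneg h'.nonneg
  contDiffOn := h.contDiffOn.mul h'.contDiffOn
  abs_le_one x := by
    rw [abs_mul]; exact mul_le_one₀ (h.abs_le_one x) (abs_nonneg _) (h'.abs_le_one x)
  integral_le H hH k₀ η hη := by
    have hc := hS.isClosed_inter H k₀ η
    have hi : ∀ {b}, ContDiffOn ℝ 1 b U → IntegrableOn
        (fun x => |jacobianDet (Function.update (fun k => (H k).deriv π) k₀ b) x|)
        ({x | sqDist x₀ x ≤ R ^ 2} ∩ {x | ∀ k ≠ k₀, |(H k).deriv π x| ≤ η k}) := fun hb =>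
      ((hS.continuousOn_jacobianDet_update H k₀ hb).abs.integrableOn_compact
        (isCompact_sqDist_le x₀ R)).mono_set Set.inter_subset_left
    have := integral_add (hi h.contDiffOn) (hi h'.contDiffOn)
    rw [add_mul]
    refine le_trans ?_ (add_le_add (h.integral_le H hH k₀ η hη) (h'.integral_le H hH k₀ η hη))
    rw [← this]
    refine setIntegral_mono_on (hi (h.contDiffOn.mul h'.contDiffOn))
      ((hi h.contDiffOn).add (hi h'.contDiffOn)) hc.measurableSet fun x hx => ?_
    have hxU := hS.isOpen.mem_nhds (hS.subset hx.1)
    rw [jacobianDet_update_mul ((h.contDiffOn.contDiffAt hxU).differentiableAt one_ne_zero)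
      ((h'.contDiffOn.contDiffAt hxU).differentiableAt one_ne_zero)]
    refine (abs_add_le _ _).trans ?_
    rw [abs_mul, abs_mul, add_comm]
    exact add_le_add (mul_le_of_le_one_left (abs_nonneg _) (h'.abs_le_one x))
      (mul_le_of_le_one_left (abs_nonneg _) (h.abs_le_one x))

theorem isAmplitude_mul_prod (hS : TreeSystem K N x₀ R U π) {ι : Type*} (s : Finset ι)
    {g : ι → (Fin d → ℝ) → ℝ} (h : IsAmplitude K x₀ R U π V a)
    (h' : ∀ i ∈ s, IsAmplitude K x₀ R U π V' (g i)) :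
    IsAmplitude K x₀ R U π (V + s.card * V') fun x => a x * ∏ i ∈ s, g i x := by
  classical
  induction s using Finset.induction_on with
  | empty => simpa using h
  | insert i s hi ih =>
    have := hS.isAmplitude_mul (ih fun j hj => h' j (Finset.mem_insert_of_mem hj))
      (h' i (Finset.mem_insert_self i s))
    simp only [Finset.prod_insert hi, Finset.card_insert_of_notMem hi]
    convert this using 1
    · push_cast; ring
    · ext x; ring

theorem isAmplitude_comp (hS : TreeSystem K N x₀ R U π) {v : ℝ} {χ : ℝ → ℝ} (hχ : IsCutoff v χ)
    {T : DTree d M₀} (hT : T.depth ≤ K) :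
    IsAmplitude K x₀ R U π (N * v) fun x => χ (T.deriv π x) where
  nonneg := mul_nonneg (Nat.cast_nonneg _)
    ((integral_abs_deriv_nonneg χ).trans hχ.integral_abs_deriv_le)
  contDiffOn := hχ.contDiff.comp_contDiffOn (hS.contDiffOn_one T)
  abs_le_one x := hχ.abs_le_one _
  integral_le H hH k₀ η hη := by
    set H' := Function.update H k₀ T with hH'
    have hF' : Function.update (fun k => (H k).deriv π) k₀ (T.deriv π) =
        fun k => (H' k).deriv π := by
      ext k : 1
      by_cases hk : k = k₀
      · subst hk; simp [hH']
      · simp [hH', hk]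
    have hd : ∀ k, (H' k).depth ≤ K := fun k => by
      by_cases hk : k = k₀
      · subst hk; simpa [hH'] using hT
      · simpa [hH', hk] using hH k
    have hdiff : ∀ x ∈ {x | sqDist x₀ x ≤ R ^ 2}, ∀ T : DTree d M₀,
        DifferentiableAt ℝ (T.deriv π) x := fun x hx T =>
      ((hS.contDiffOn_one T).contDiffAt
        (hS.isOpen.mem_nhds (hS.subset hx))).differentiableAt one_ne_zero
    have key := setIntegral_abs_jacobianDet_mul_le (isCompact_sqDist_le x₀ R)
      (fun x hx k => hdiff x hx (H' k))
      (hF' ▸ hS.continuousOn_jacobianDet_update H k₀ (hS.contDiffOn_one T)) N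
      (hS.ball H' hd) k₀ (hχ.contDiff.continuous_deriv le_rfl).abs (fun _ => abs_nonneg _)
      hχ.integrable_deriv.abs hη
    have hset : {x | ∀ k ≠ k₀, |(H' k).deriv π x| ≤ η k} =
        {x | ∀ k ≠ k₀, |(H k).deriv π x| ≤ η k} := by
      ext x
      refine forall₂_congr fun k hk => ?_
      simp [hH', hk]
    rw [hset] at key
    refine le_trans (le_of_eq ?_) (key.trans (mul_le_mul_of_nonneg_right
      (mul_le_mul_of_nonneg_left hχ.integral_abs_deriv_le (Nat.cast_nonneg _))
      (Finset.prod_nonneg fun k _ => by linarith [hη k])))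
    refine setIntegral_congr_fun (hS.isClosed_inter H k₀ η).measurableSet fun x hx => ?_
    have hk₀ : H' k₀ = T := by simp [hH']
    rw [jacobianDet_update_comp (χ := χ) (g := T.deriv π)
      (hχ.contDiff.differentiable one_ne_zero _) (hdiff x hx.1 T), hF', abs_mul, mul_comm, hk₀]

end TreeSystem
end Trees

section Trees
variable {d M₀ : ℕ}

theorem prod_erase_two_mul {D : Fin d → ℝ} (k₀ : Fin d) :
    D k₀ * ∏ k ∈ Finset.univ.erase k₀, (2 * (2 * D k)) = 4 ^ (d - 1) * ∏ k, D k := by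
  rw [← Finset.mul_prod_erase _ _ (Finset.mem_univ k₀)]
  have : ∏ k ∈ Finset.univ.erase k₀, (2 * (2 * D k)) =
      4 ^ (d - 1) * ∏ k ∈ Finset.univ.erase k₀, D k := by
    simp_rw [← mul_assoc]
    rw [Finset.prod_mul_distrib, Finset.prod_const, Finset.card_erase_of_mem (Finset.mem_univ _),
      Finset.card_univ, Fintype.card_fin]
    norm_num
  rw [this]; ring

namespace TreeSystem
variable {K N : ℕ} {x₀ : Fin d → ℝ} {R : ℝ} {U : Set (Fin d → ℝ)}
  {π : Fin M₀ → (Fin d → ℝ) → ℝ} {V : ℝ} {a : (Fin d → ℝ) → ℝ}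

theorem continuousOn_deriv (hS : TreeSystem K N x₀ R U π) (T : DTree d M₀) :
    ContinuousOn (T.deriv π) {x | sqDist x₀ x ≤ R ^ 2} :=
  (hS.contDiffOn T).continuousOn.mono hS.subset

/-- Without an oscillating component the amplitude alone localizes all components. -/
theorem abs_integral_le_of_forall (hS : TreeSystem K N x₀ R U π) (hd : 0 < d)
    {H : Fin d → DTree d M₀} (hH : ∀ k, (H k).depth ≤ K) {t : ℝ} (ht : 0 < t)
    {D : Fin d → ℝ} (hD : ∀ k, 0 < D k) {w : (Fin d → ℝ) → ℝ}
    (hw : ContinuousOn w {x | sqDist x₀ x ≤ R ^ 2}) (hw1 : ∀ x, |w x| ≤ 1)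
    (hsupp : ∀ x, w x ≠ 0 → ∀ k, |(H k).deriv π x| ≤ 2 * D k) :
    |∫ x in {x | sqDist x₀ x ≤ R ^ 2},
      w x * farCut ((DTree.node H).deriv π x / (t⁻¹ * ∏ k, D k))| ≤ 4 ^ (d + 1) * N * t := by
  set B := {x | sqDist x₀ x ≤ R ^ 2} with hB
  have hBc : IsCompact B := isCompact_sqDist_le x₀ R
  set J := (DTree.node H).deriv π with hJ
  set δ := t⁻¹ * ∏ k, D k with hδ
  have hDprod : 0 < ∏ k, D k := Finset.prod_pos fun k _ => hD k
  have hδ0 : 0 < δ := by positivity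
  let k₀ : Fin d := ⟨0, hd⟩
  set E := B ∩ {x | ∀ k ≠ k₀, |(H k).deriv π x| ≤ 2 * D k} with hE
  have hEm : MeasurableSet E := (hS.isClosed_inter H k₀ _).measurableSet
  have hJc : ContinuousOn J B := hS.continuousOn_deriv (.node H)
  have h4 : (0 : ℝ) < 4 * D k₀ := by linarith [hD k₀]
  have hgc : Continuous fun s => nearCut (s / (4 * D k₀)) :=
    isCutoff_nearCut.contDiff.continuous.comp (by fun_prop)
  have hred := setIntegral_eq_of_subset_of_forall_sdiff_eq_zero (μ := volume)
    (f := fun x => w x * farCut (J x / δ)) hBc.measurableSet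
    (Set.inter_subset_left : E ⊆ B) (fun x hx => by
      have : w x = 0 := by
        by_contra hne
        exact hx.2 ⟨hx.1, fun k _ => hsupp x hne k⟩
      simp [this])
  have harea := setIntegral_abs_jacobianDet_mul_le (F := fun k => (H k).deriv π) hBc
    (fun x hx k => ((hS.contDiffOn_one (H k)).contDiffAt
      (hS.isOpen.mem_nhds (hS.subset hx))).differentiableAt one_ne_zero)
    hJc N (hS.ball H hH) k₀ hgc (fun _ => nearCut_nonneg _)
    (integrable_nearCut.comp_div h4.ne') (η := fun k => 2 * D k)
    (fun k => by linarith [hD k])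
  have hfint : ∫ s, nearCut (s / (4 * D k₀)) ≤ 8 * D k₀ := by
    rw [Measure.integral_comp_div (fun s => nearCut s), abs_of_pos h4, smul_eq_mul]
    nlinarith [integral_nearCut_le]
  rw [hred]
  calc |∫ x in E, w x * farCut (J x / δ)| ≤ ∫ x in E, |w x * farCut (J x / δ)| :=
        abs_integral_le_integral_abs
    _ ≤ ∫ x in E, 2 / δ * (|J x| * nearCut ((H k₀).deriv π x / (4 * D k₀))) := by
        refine setIntegral_mono_on ?_ ?_ hEm fun x hx => ?_
        · refine IntegrableOn.mono_set (t := B) ?_ Set.inter_subset_left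
          exact ContinuousOn.integrableOn_compact hBc (hw.mul
            (contDiff_farCut.continuous.comp_continuousOn (hJc.div_const δ))).abs
        · refine IntegrableOn.mono_set (t := B) ?_ Set.inter_subset_left
          exact ContinuousOn.integrableOn_compact hBc (continuousOn_const.mul (hJc.abs.mul
            (hgc.comp_continuousOn (hS.continuousOn_deriv (H k₀)))))
        · by_cases hwx : w x = 0
          · rw [hwx, zero_mul, abs_zero]
            have := nearCut_nonneg ((H k₀).deriv π x / (4 * D k₀))
            positivity
          · rw [nearCut_of_le, mul_one, abs_mul, abs_of_nonneg (farCut_nonneg _)]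
            · calc |w x| * farCut (J x / δ) ≤ 1 * (2 * |J x / δ|) :=
                    mul_le_mul (hw1 x) (farCut_le _) (farCut_nonneg _) zero_le_one
                _ = 2 / δ * |J x| := by rw [abs_div, abs_of_pos hδ0]; ring
            · rw [abs_div, abs_of_pos h4, div_le_iff₀ h4]
              linarith [hsupp x hwx k₀]
    _ = 2 / δ * ∫ x in E, |J x| * nearCut ((H k₀).deriv π x / (4 * D k₀)) :=
        integral_const_mul _ _
    _ ≤ 2 / δ * (N * (8 * D k₀) * ∏ k ∈ Finset.univ.erase k₀, (2 * (2 * D k))) := by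
        refine mul_le_mul_of_nonneg_left (harea.trans ?_) (by positivity)
        refine mul_le_mul_of_nonneg_right (mul_le_mul_of_nonneg_left hfint (Nat.cast_nonneg _))
          (Finset.prod_nonneg fun k _ => by linarith [hD k])
    _ = 2 / δ * (N * 8 * (4 ^ (d - 1) * ∏ k, D k)) := by
        rw [← prod_erase_two_mul k₀]; ring
    _ = 4 ^ (d + 1) * N * t := by
        obtain ⟨n, rfl⟩ : ∃ n, d = n + 1 := ⟨d - 1, by omega⟩
        rw [hδ]
        field_simp
        simp only [Nat.add_sub_cancel]
        ring

theorem abs_integral_le_of_unique (hS : TreeSystem K N x₀ R U π)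
    {H : Fin d → DTree d M₀} (hH : ∀ k, (H k).depth ≤ K) (hHK : (DTree.node H).depth ≤ K)
    {p : Fin M₀} {k₀ : Fin d} (hk₀ : H k₀ = .leaf p) {t : ℝ} (ht : 0 < t)
    {D : Fin d → ℝ} (hD : ∀ k, 0 < D k) {ψ Ψ : ℝ → ℝ} (hΨ : ∀ s, HasDerivAt Ψ (ψ s) s)
    (hψ : Continuous ψ) (hΨ1 : ∀ s, |Ψ s| ≤ D k₀)
    (ha : IsAmplitude K x₀ R U π V a)
    (hsupp : ∀ x, a x ≠ 0 → ∀ k ≠ k₀, |(H k).deriv π x| ≤ 2 * D k) :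
    |∫ x in {x | sqDist x₀ x ≤ R ^ 2},
      a x * (farCut ((DTree.node H).deriv π x / (t⁻¹ * ∏ k, D k)) * ψ (π p x))| ≤
        4 ^ (d + 1) * (V + 2 * (N * cutoffVariation)) * t := by
  set B := {x | sqDist x₀ x ≤ R ^ 2} with hB
  have hBc : IsCompact B := isCompact_sqDist_le x₀ R
  set J := (DTree.node H).deriv π with hJ
  set δ := t⁻¹ * ∏ k, D k with hδ
  have hDprod : 0 < ∏ k, D k := Finset.prod_pos fun k _ => hD k
  have hδ0 : 0 < δ := by positivity
  set F := fun k => (H k).deriv π with hF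
  have hFk₀ : F k₀ = π p := by simp only [hF, hk₀]; rfl
  set b := fun x => a x * farInv (J x / δ) with hb
  have hbA : IsAmplitude K x₀ R U π (V + N * cutoffVariation) b :=
    hS.isAmplitude_mul ha (hS.isAmplitude_comp (isCutoff_farInv.comp_div hδ0.ne') hHK)
  have hΨd : deriv Ψ = ψ := funext fun s => (hΨ s).deriv
  have hΨc : ContDiff ℝ 1 Ψ :=
    contDiff_one_iff_deriv.2 ⟨fun s => (hΨ s).differentiableAt, by rwa [hΨd]⟩
  have hπp : ContDiffOn ℝ 1 (π p) U := hS.contDiffOn_one (.leaf p)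
  have hg : ContDiffOn ℝ 1 (fun x => Ψ (π p x)) U := hΨc.comp_contDiffOn hπp
  have hdiff : ∀ {f : (Fin d → ℝ) → ℝ}, ContDiffOn ℝ 1 f U → ∀ x ∈ B, DifferentiableAt ℝ f x :=
    fun hf x hx => (hf.contDiffAt
      (hS.isOpen.mem_nhds (hS.subset hx))).differentiableAt one_ne_zero
  have hbsupp : ∀ x, b x ≠ 0 → ∀ k ≠ k₀, |F k x| ≤ 2 * D k := fun x hx =>
    hsupp x (left_ne_zero_of_mul hx)
  have hη : ∀ k, 0 ≤ 2 * D k := fun k => by linarith [hD k]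
  set Q := ∏ k ∈ Finset.univ.erase k₀, (2 * (2 * D k)) with hQ
  have hQ0 : 0 ≤ Q := Finset.prod_nonneg fun k _ => by linarith [hη k]
  have hbound := abs_integral_jacobianDet_update_le hS.pos hS.isOpen hS.subset
    (fun k => hS.contDiffOn (H k)) k₀ N (hS.sphere H hH k₀)
    (u := fun x => b x * Ψ (π p x)) (hbA.contDiffOn.mul hg) (hD k₀).le
    (fun x _ => by
      rw [abs_mul]
      exact (mul_le_of_le_one_left (abs_nonneg _) (hbA.abs_le_one x)).trans (hΨ1 _)) hη
    (fun x _ hx => hbsupp x (left_ne_zero_of_mul hx))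
  have hT : (∫ s, |deriv Real.smoothTransition s|) ≤ cutoffVariation :=
    isCutoff_smoothTransition.integral_abs_deriv_le
  set E := B ∩ {x | ∀ k ≠ k₀, |F k x| ≤ 2 * D k} with hE
  set Jb := jacobianDet (Function.update F k₀ b) with hJb
  have hJbc : ContinuousOn Jb B := hS.continuousOn_jacobianDet_update H k₀ hbA.contDiffOn
  have hJbint : ∫ x in B, |Jb x| ≤ (V + N * cutoffVariation) * Q := by
    have hred := setIntegral_eq_of_subset_of_forall_sdiff_eq_zero (μ := volume)
      (f := fun x => |Jb x|) hBc.measurableSet (Set.inter_subset_left : E ⊆ B) (fun x hx => by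
        obtain ⟨k, hk, hlt⟩ : ∃ k ≠ k₀, 2 * D k < |F k x| := by
          by_contra! hcon
          exact hx.2 ⟨hx.1, hcon⟩
        have hev : b =ᶠ[nhds x] fun _ => 0 := by
          have hcF : ContinuousAt (F k) x :=
            (hdiff (hS.contDiffOn_one (H k)) x hx.1).continuousAt
          filter_upwards [continuousAt_const.eventually_lt hcF.abs hlt] with y hy
          by_contra hne
          exact absurd (hbsupp y hne k hk) (not_le.2 hy)
        have : Jb x = 0 := jacobianDet_update_eq_zero (by rw [hev.fderiv_eq]; simp)
        rw [this, abs_zero])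
    rw [hred]
    exact hbA.integral_le H hH k₀ _ hη
  have hpt : ∀ x ∈ B, a x * (farCut (J x / δ) * ψ (π p x)) =
      2 / δ * (jacobianDet (Function.update F k₀ fun x => b x * Ψ (π p x)) x -
        Ψ (π p x) * Jb x) := by
    intro x hx
    rw [jacobianDet_update_mul (hdiff hbA.contDiffOn x hx) (hdiff hg x hx),
      jacobianDet_update_comp (χ := Ψ) (g := π p) (hΨ _).differentiableAt (hdiff hπp x hx),
      hΨd, ← hFk₀, Function.update_eq_self, farCut_eq_mul_farInv]
    have : jacobianDet F x = J x := rfl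
    rw [this]
    simp only [hb]
    ring
  have hi1 : IntegrableOn (jacobianDet (Function.update F k₀ fun x => b x * Ψ (π p x))) B :=
    (hS.continuousOn_jacobianDet_update H k₀ (hbA.contDiffOn.mul hg)).integrableOn_compact hBc
  have hi2 : IntegrableOn (fun x => Ψ (π p x) * Jb x) B :=
    ((hg.continuousOn.mono hS.subset).mul hJbc).integrableOn_compact hBc
  rw [setIntegral_congr_fun hBc.measurableSet hpt, integral_const_mul, integral_sub hi1 hi2,
    abs_mul, abs_of_pos (by positivity : 0 < 2 / δ)]
  have hsecond : |∫ x in B, Ψ (π p x) * Jb x| ≤ D k₀ * ((V + N * cutoffVariation) * Q) := by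
    calc |∫ x in B, Ψ (π p x) * Jb x| ≤ ∫ x in B, |Ψ (π p x) * Jb x| :=
          abs_integral_le_integral_abs
      _ ≤ ∫ x in B, D k₀ * |Jb x| := by
          refine setIntegral_mono_on hi2.abs ?_ hBc.measurableSet fun x _ => ?_
          · exact (continuousOn_const.mul hJbc.abs).integrableOn_compact hBc
          · rw [abs_mul]
            exact mul_le_mul_of_nonneg_right (hΨ1 _) (abs_nonneg _)
      _ ≤ _ := by
          rw [integral_const_mul]
          exact mul_le_mul_of_nonneg_left hJbint (hD k₀).le
  have hfirst : |∫ x in B, jacobianDet (Function.update F k₀ fun x => b x * Ψ (π p x)) x| ≤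
      D k₀ * (N * cutoffVariation * Q) := by
    refine hbound.trans ?_
    have hN : (0 : ℝ) ≤ N * D k₀ * Q := mul_nonneg (mul_nonneg (Nat.cast_nonneg _) (hD k₀).le) hQ0
    nlinarith [mul_le_mul_of_nonneg_left hT hN]
  have hDQ : D k₀ * Q = 4 ^ (d - 1) * ∏ k, D k := prod_erase_two_mul k₀
  calc _ ≤ 2 / δ * (D k₀ * (N * cutoffVariation * Q) +
        D k₀ * ((V + N * cutoffVariation) * Q)) :=
        mul_le_mul_of_nonneg_left ((abs_sub _ _).trans (add_le_add hfirst hsecond))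
          (by positivity)
    _ = 2 / δ * ((V + 2 * (N * cutoffVariation)) * (D k₀ * Q)) := by ring
    _ = 2 * 4 ^ (d - 1) * (V + 2 * (N * cutoffVariation)) * t := by
        rw [hDQ, hδ]
        field_simp
    _ ≤ _ := by
        have h1 : 0 ≤ V + 2 * (N * cutoffVariation) := add_nonneg ha.nonneg
          (mul_nonneg zero_le_two (mul_nonneg (Nat.cast_nonneg _) cutoffVariation_nonneg))
        have h2 : (2 : ℝ) * 4 ^ (d - 1) ≤ 4 ^ (d + 1) := by
          have : (4 : ℝ) ^ (d - 1) ≤ 4 ^ d := pow_le_pow_right₀ (by norm_num) (by omega)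
          have h0 : (0 : ℝ) < 4 ^ d := by positivity
          rw [pow_succ]; linarith
        exact mul_le_mul_of_nonneg_right (mul_le_mul_of_nonneg_right h2 h1) ht.le

/-- The oscillatory estimate for `∂^G π` when all components of `G` are localized. -/
theorem abs_integral_farCut_le (hS : TreeSystem K N x₀ R U π) (hd : 0 < d)
    {H : Fin d → DTree d M₀} (hHK : (DTree.node H).depth ≤ K)
    {p : Fin M₀} {t : ℝ} (ht : 0 < t)
    {D : Fin d → ℝ} (hD : ∀ k, 0 < D k) {ψ Ψ : ℝ → ℝ} (hΨ : ∀ s, HasDerivAt Ψ (ψ s) s)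
    (hψ : Continuous ψ) (hψ1 : ∀ s, |ψ s| ≤ 1) (hΨ1 : ∀ s k, H k = .leaf p → |Ψ s| ≤ D k)
    (ha : IsAmplitude K x₀ R U π V a)
    (hsupp : ∀ x, a x ≠ 0 → ∀ k, H k ≠ .leaf p → |(H k).deriv π x| ≤ 2 * D k) :
    |∫ x in {x | sqDist x₀ x ≤ R ^ 2},
      a x * (farCut ((DTree.node H).deriv π x / (t⁻¹ * ∏ k, D k)) * ψ (π p x))| ≤
        4 ^ (d + 1) * (N + V + 2 * (N * cutoffVariation)) * t := by
  have hH : ∀ k, (H k).depth ≤ K := by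
    obtain ⟨K', rfl⟩ : ∃ K', K = K' + 1 := ⟨K - 1, by rw [DTree.depth_node] at hHK; omega⟩
    exact fun k => (DTree.depth_node_le_succ.1 hHK k).trans (Nat.le_succ _)
  have hN : (0 : ℝ) ≤ N := Nat.cast_nonneg _
  have hv := mul_nonneg hN cutoffVariation_nonneg
  have hV := ha.nonneg
  by_cases hex : ∃ k₀, H k₀ = .leaf p
  · obtain ⟨k₀, hk₀⟩ := hex
    by_cases huniq : ∀ k ≠ k₀, H k ≠ .leaf p
    · refine (hS.abs_integral_le_of_unique hH hHK hk₀ ht hD hΨ hψ (fun s => hΨ1 s k₀ hk₀) ha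
        fun x hx k hk => hsupp x hx k (huniq k hk)).trans ?_
      gcongr
      linarith
    · push Not at huniq
      obtain ⟨k, hk, hkp⟩ := huniq
      have : ∀ x, (DTree.node H).deriv π x = 0 := fun x =>
        jacobianDet_eq_zero_of_eq hk (by rw [hkp, hk₀])
      simp only [this, zero_div, farCut_zero, zero_mul, mul_zero, integral_zero, abs_zero]
      positivity
  · push Not at hex
    have hw : ContinuousOn (fun x => a x * ψ (π p x)) {x | sqDist x₀ x ≤ R ^ 2} :=
      (ha.contDiffOn.continuousOn.mono hS.subset).mul
        (hψ.comp_continuousOn (hS.continuousOn_deriv (.leaf p)))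
    have := hS.abs_integral_le_of_forall hd hH ht hD hw (fun x => by
      rw [abs_mul]; exact mul_le_one₀ (ha.abs_le_one x) (abs_nonneg _) (hψ1 _))
      (fun x hx k => hsupp x (left_ne_zero_of_mul hx) k (hex k))
    have he : ∀ x, a x * (farCut ((DTree.node H).deriv π x / (t⁻¹ * ∏ k, D k)) * ψ (π p x)) =
        a x * ψ (π p x) * farCut ((DTree.node H).deriv π x / (t⁻¹ * ∏ k, D k)) := fun x => by ring
    simp only [he]
    refine this.trans ?_
    gcongr
    linarith

end TreeSystem
end Trees

section Trees
variable {d M₀ : ℕ}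

/-- The natural size of `∂^T π` when `π_j` has size `e_j` and a level set has measure `t`. -/
noncomputable def DTree.weight (t : ℝ) (e : Fin M₀ → ℝ) (T : DTree d M₀) : ℝ :=
  t⁻¹ ^ T.count * ∏ j, e j ^ T.mult j

namespace DTree

theorem weight_leaf (t : ℝ) (e : Fin M₀ → ℝ) (i : Fin M₀) :
    (leaf i : DTree d M₀).weight t e = e i := by
  have h1 : (leaf i : DTree d M₀).count = 0 := rfl
  have h2 : ∀ j, (leaf i : DTree d M₀).mult j = if i = j then 1 else 0 := fun _ => rfl
  simp [weight, h1, h2, pow_ite]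

theorem weight_node (t : ℝ) (e : Fin M₀ → ℝ) (H : Fin d → DTree d M₀) :
    (node H).weight t e = t⁻¹ * ∏ k, (H k).weight t e := by
  have h1 : (node H).count = ∑ k, (H k).count + 1 := rfl
  have h2 : ∀ j, (node H).mult j = ∑ k, (H k).mult j := fun _ => rfl
  simp only [weight, h1, h2, Finset.prod_mul_distrib, Finset.prod_pow_eq_pow_sum, pow_succ]
  rw [Finset.prod_comm]
  simp only [Finset.prod_pow_eq_pow_sum]
  ring

theorem weight_pos {t : ℝ} (ht : 0 < t) {e : Fin M₀ → ℝ} (he : ∀ j, 0 < e j) (T : DTree d M₀) :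
    0 < T.weight t e :=
  mul_pos (pow_pos (inv_pos.2 ht) _) (Finset.prod_pos fun j _ => pow_pos (he j) _)

end DTree

/-- The constant produced by the recursion on the depth of a tree. -/
noncomputable def iterBound (d N : ℕ) : ℕ → ℝ → ℝ
  | 0, _ => 0
  | k + 1, V => 4 ^ (d + 1) * (N + (V + d * (N * cutoffVariation)) + 2 * (N * cutoffVariation)) +
      d * iterBound d N k (V + (d + 1) * (N * cutoffVariation))

theorem mul_cutoffVariation_nonneg (N : ℕ) : 0 ≤ N * cutoffVariation :=
  mul_nonneg (Nat.cast_nonneg _) cutoffVariation_nonneg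

theorem iterBound_nonneg (d N k : ℕ) {V : ℝ} (hV : 0 ≤ V) : 0 ≤ iterBound d N k V := by
  induction k generalizing V with
  | zero => exact le_rfl
  | succ k ih =>
    have h := mul_cutoffVariation_nonneg N
    have := ih (V := V + (d + 1) * (N * cutoffVariation)) (by positivity)
    rw [iterBound]
    positivity

namespace TreeSystem
variable {K N : ℕ} {x₀ : Fin d → ℝ} {R : ℝ} {U : Set (Fin d → ℝ)}
  {π : Fin M₀ → (Fin d → ℝ) → ℝ} {V : ℝ} {a : (Fin d → ℝ) → ℝ}

theorem abs_integral_farCut_weight_le (hS : TreeSystem K N x₀ R U π) (hd : 0 < d)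
    {p : Fin M₀} {t : ℝ} (ht : 0 < t) {e : Fin M₀ → ℝ} (he : ∀ j, 0 < e j)
    {ψ Ψ : ℝ → ℝ} (hΨ : ∀ s, HasDerivAt Ψ (ψ s) s) (hψ : Continuous ψ) (hψ1 : ∀ s, |ψ s| ≤ 1)
    (hΨ1 : ∀ s, |Ψ s| ≤ e p) {k : ℕ} (hk : k ≤ K) {H : Fin d → DTree d M₀}
    (hH : (DTree.node H).depth ≤ k) (hlt : (DTree.node H).leavesLT (p + 1))
    (ha : IsAmplitude K x₀ R U π V a)
    (hsupp : ∀ x, a x ≠ 0 → ∀ j < p, |π j x| ≤ 2 * e j) :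
    |∫ x in {x | sqDist x₀ x ≤ R ^ 2},
      a x * (farCut ((DTree.node H).deriv π x / (DTree.node H).weight t e) * ψ (π p x))| ≤
        iterBound d N k V * t := by
  classical
  induction k generalizing H V a with
  | zero => rw [DTree.depth_node] at hH; omega
  | succ k ih =>
    set B := {x | sqDist x₀ x ≤ R ^ 2} with hB
    have hBc : IsCompact B := isCompact_sqDist_le x₀ R
    set v := N * cutoffVariation with hv
    have hv0 : 0 ≤ v := mul_cutoffVariation_nonneg N
    have hV0 := ha.nonneg
    have hHk : ∀ i, (H i).depth ≤ k := DTree.depth_node_le_succ.1 hH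
    have hHK : ∀ i, (H i).depth ≤ K := fun i => (hHk i).trans (by omega)
    set w : Fin d → ℝ := fun i => (H i).weight t e with hw
    have hw0 : ∀ i, 0 < w i := fun i => DTree.weight_pos ht he _
    have hδ0 : 0 < (DTree.node H).weight t e := DTree.weight_pos ht he _
    set f : Fin d → (Fin d → ℝ) → ℝ := fun i x =>
      if (H i).Nontrivial then farCut ((H i).deriv π x / w i) else 0 with hf
    set g : Fin d → (Fin d → ℝ) → ℝ := fun i x => 1 - f i x with hg
    have hgA : ∀ i, IsAmplitude K x₀ R U π v (g i) := by
      intro i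
      by_cases hi : (H i).Nontrivial
      · have : g i = fun x => nearCut ((H i).deriv π x / w i) := by
          ext x; simp only [hg, hf, hi, if_true, nearCut]
        rw [this]
        exact hS.isAmplitude_comp (isCutoff_nearCut.comp_div (hw0 i).ne') (hHK i)
      · have : g i = fun x => 1 := by
          ext x; simp only [hg, hf, hi, if_false, sub_zero]
        rw [this]
        exact IsAmplitude.one.mono hv0
    set X : (Fin d → ℝ) → ℝ := fun x =>
      farCut ((DTree.node H).deriv π x / (DTree.node H).weight t e) * ψ (π p x) with hX
    have hXc : ContinuousOn X B :=
      (contDiff_farCut.continuous.comp_continuousOn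
        ((hS.continuousOn_deriv (.node H)).div_const _)).mul
        (hψ.comp_continuousOn (hS.continuousOn_deriv (.leaf p)))
    have hAc : ∀ {V b}, IsAmplitude K x₀ R U π V b → ContinuousOn b B := fun hb =>
      hb.contDiffOn.continuousOn.mono hS.subset
    have hmainA := hS.isAmplitude_mul_prod Finset.univ ha fun i _ => hgA i
    rw [Finset.card_univ, Fintype.card_fin] at hmainA
    have hpartA : ∀ i, IsAmplitude K x₀ R U π (V + d * v)
        fun x => a x * ∏ j ∈ Finset.univ with j < i, g j x := fun i => by
      refine (hS.isAmplitude_mul_prod _ ha fun j _ => hgA j).mono ?_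
      have : (Finset.card (Finset.univ.filter fun j => j < i) : ℝ) ≤ d := by
        exact_mod_cast (Finset.card_filter_le _ _).trans (by simp)
      gcongr
    have hfc : ∀ i, ContinuousOn (f i) B := fun i => by
      have : f i = fun x => 1 - g i x := by ext x; simp [hg]
      rw [this]
      exact continuousOn_const.sub (hAc (hgA i))
    have hpt : ∀ x, a x * X x = (a x * ∏ i, g i x) * X x +
        ∑ i, (a x * ∏ j ∈ Finset.univ with j < i, g j x) * f i x * X x := by
      intro x
      have h1 := Finset.prod_one_sub_ordered Finset.univ fun i => f i x
      have h2 : 1 = (∏ i, g i x) + ∑ i, f i x * ∏ j ∈ Finset.univ with j < i, g j x := by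
        simp only [hg]; linarith
      calc a x * X x = a x * X x * 1 := (mul_one _).symm
        _ = _ := by
          nth_rewrite 1 [h2]
          rw [mul_add, Finset.mul_sum]
          congr 1
          · ring
          · exact Finset.sum_congr rfl fun i _ => by ring
    have hi0 : IntegrableOn (fun x => (a x * ∏ i, g i x) * X x) B :=
      ((hAc hmainA).mul hXc).integrableOn_compact hBc
    have hi1 : ∀ i ∈ Finset.univ, IntegrableOn
        (fun x => (a x * ∏ j ∈ Finset.univ with j < i, g j x) * f i x * X x) B := fun i _ =>
      (((hAc (hpartA i)).mul (hfc i)).mul hXc).integrableOn_compact hBc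
    have hsplit : ∫ x in B, a x * X x = (∫ x in B, (a x * ∏ i, g i x) * X x) +
        ∑ i, ∫ x in B, (a x * ∏ j ∈ Finset.univ with j < i, g j x) * f i x * X x := by
      rw [← integral_finsetSum _ hi1, ← integral_add hi0 (integrable_finsetSum _ hi1)]
      exact integral_congr_ae (Filter.Eventually.of_forall hpt)
    have hmain : |∫ x in B, (a x * ∏ i, g i x) * X x| ≤
        4 ^ (d + 1) * (N + (V + d * v) + 2 * v) * t := by
      have := hS.abs_integral_farCut_le hd (hH.trans hk) (p := p) ht hw0 hΨ hψ hψ1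
        (fun s i hi => by simpa only [hw, hi, DTree.weight_leaf] using hΨ1 s) hmainA
        (fun x hx i hip => by
          have hgi : g i x ≠ 0 :=
            Finset.prod_ne_zero_iff.1 (right_ne_zero_of_mul hx) i (Finset.mem_univ i)
          by_cases hi : (H i).Nontrivial
          · by_contra! hcon
            refine hgi ?_
            simp only [hg, hf, hi, if_true]
            rw [farCut_of_one_le, sub_self]
            rw [abs_div, abs_of_pos (hw0 i), le_div_iff₀ (hw0 i)]
            linarith [hw0 i]
          · obtain ⟨j, hj⟩ : ∃ j, H i = .leaf j := by
              simpa only [DTree.Nontrivial, not_forall, not_not] using hi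
            have hjp : j ≠ p := fun h => hip (by rw [hj, h])
            have hjlt : (j : ℕ) < p + 1 := by
              have : (H i).leavesLT (p + 1) := hlt i
              rw [hj] at this
              exact this
            have hjp' : j < p := lt_of_le_of_ne (Nat.lt_succ_iff.1 hjlt) hjp
            simp only [hw, hj, DTree.weight_leaf]
            exact hsupp x (left_ne_zero_of_mul hx) j hjp')
      rw [← DTree.weight_node] at this
      exact this
    have hpart : ∀ i, |∫ x in B, (a x * ∏ j ∈ Finset.univ with j < i, g j x) * f i x * X x| ≤
        iterBound d N k (V + (d + 1) * v) * t := by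
      intro i
      cases hi : H i with
      | leaf j =>
        have hf0 : ∀ x, f i x = 0 := fun x => by
          have : ¬ (H i).Nontrivial := fun h => h j hi
          simp only [hf, this, if_false]
        simp only [hf0, mul_zero, zero_mul, integral_zero, abs_zero]
        exact mul_nonneg (iterBound_nonneg d N k (by positivity)) ht.le
      | node H' =>
        have hAi := hS.isAmplitude_mul (hpartA i)
          (hS.isAmplitude_comp (isCutoff_farCut.comp_div hδ0.ne') (hH.trans hk))
        have := ih (by omega) (H := H') (hi ▸ hHk i) (hi ▸ hlt i)
          (hAi.mono (V' := V + (d + 1) * v) (by linarith)) (fun x hx =>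
            hsupp x (left_ne_zero_of_mul (left_ne_zero_of_mul hx)))
        refine le_trans (le_of_eq ?_) this
        congr 2
        ext x
        simp only [hf, hX, hw, hi, DTree.nontrivial_node H', if_true]
        ring
    rw [hsplit, iterBound, add_mul]
    refine (abs_add_le _ _).trans (add_le_add hmain ((Finset.abs_sum_le_sum_abs _ _).trans ?_))
    refine (Finset.sum_le_sum fun i _ => hpart i).trans (le_of_eq ?_)
    rw [Finset.sum_const, Finset.card_univ, Fintype.card_fin, nsmul_eq_mul, mul_assoc]

end TreeSystem
end Trees

section Trees
variable {d M₀ : ℕ}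

/-- A smooth approximation, sharper as `n` grows, of the indicator of `|s| ≤ e_j` for `j < p`
and of `0 ≤ s` for `p < j`. -/
noncomputable def domainCut (p : Fin M₀) (e : Fin M₀ → ℝ) (n : ℕ) (j : Fin M₀) (s : ℝ) : ℝ :=
  if j < p then Real.smoothTransition (-((n + 1) / e j) * s + (n + 2)) *
    Real.smoothTransition ((n + 1) / e j * s + (n + 2))
  else if p < j then Real.smoothTransition ((n + 1) * s + 1) else 1

/-- The condition whose indicator is approximated by `domainCut`. -/
def DomainCond (p : Fin M₀) (e : Fin M₀ → ℝ) (j : Fin M₀) (s : ℝ) : Prop :=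
  (j < p → |s| ≤ e j) ∧ (p < j → 0 ≤ s)

theorem pos_of_smoothTransition_ne_zero {u : ℝ} (h : Real.smoothTransition u ≠ 0) : 0 < u := by
  by_contra! hu
  exact h (Real.smoothTransition.zero_of_nonpos hu)

theorem domainCut_of_cond {p : Fin M₀} {e : Fin M₀ → ℝ} (he : ∀ j, 0 < e j) (n : ℕ)
    {j : Fin M₀} {s : ℝ} (h : DomainCond p e j s) : domainCut p e n j s = 1 := by
  unfold domainCut
  split_ifs with h1 h2
  · have hs := abs_le.1 (h.1 h1)
    have hn : (0 : ℝ) ≤ n + 1 := by positivity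
    have hu : s / e j ≤ 1 := (div_le_one (he j)).2 hs.2
    have hl : -1 ≤ s / e j := (le_div_iff₀ (he j)).2 (by linarith)
    have e1 : -((n + 1 : ℝ) / e j) * s + (n + 2) = (n + 1) * (1 - s / e j) + 1 := by ring
    have e2 : (n + 1 : ℝ) / e j * s + (n + 2) = (n + 1) * (1 + s / e j) + 1 := by ring
    rw [Real.smoothTransition.one_of_one_le, Real.smoothTransition.one_of_one_le, mul_one]
    · rw [e2]; nlinarith
    · rw [e1]; nlinarith
  · exact Real.smoothTransition.one_of_one_le
      (by linarith [mul_nonneg (by positivity : (0 : ℝ) ≤ n + 1) (h.2 h2)])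
  · rfl

theorem abs_le_of_domainCut_ne_zero {p : Fin M₀} {e : Fin M₀ → ℝ} (he : ∀ j, 0 < e j) {n : ℕ}
    {j : Fin M₀} (hj : j < p) {s : ℝ} (h : domainCut p e n j s ≠ 0) : |s| ≤ 2 * e j := by
  rw [domainCut, if_pos hj] at h
  have h1 := pos_of_smoothTransition_ne_zero (left_ne_zero_of_mul h)
  have h2 := pos_of_smoothTransition_ne_zero (right_ne_zero_of_mul h)
  have e0 : s = e j * (s / e j) := by field_simp [(he j).ne']
  have e1 : -((n + 1 : ℝ) / e j) * s + (n + 2) = (n + 1) * (2 - s / e j) - n := by ring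
  have e2 : (n + 1 : ℝ) / e j * s + (n + 2) = (n + 1) * (2 + s / e j) - n := by ring
  have hn : (0 : ℝ) ≤ n := by positivity
  rw [e1] at h1
  rw [e2] at h2
  have h3 : 0 < 2 - s / e j := pos_of_mul_pos_right (by linarith) (by linarith : (0 : ℝ) ≤ n + 1)
  have h4 : 0 < 2 + s / e j := pos_of_mul_pos_right (by linarith) (by linarith : (0 : ℝ) ≤ n + 1)
  have h5 := mul_pos (he j) h3
  have h6 := mul_pos (he j) h4
  rw [abs_le]
  constructor <;> nlinarith

theorem eventually_mul_add_nonpos {δ : ℝ} (hδ : δ < 0) :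
    ∀ᶠ n : ℕ in Filter.atTop, ((n : ℝ) + 1) * δ + 1 ≤ 0 := by
  have := (tendsto_natCast_atTop_atTop (R := ℝ)).atTop_mul_const (neg_pos.2 hδ)
  filter_upwards [this.eventually_ge_atTop 1] with n hn
  linarith

theorem eventually_domainCut_eq_zero {p : Fin M₀} {e : Fin M₀ → ℝ} (he : ∀ j, 0 < e j)
    {j : Fin M₀} {s : ℝ} (h : ¬ DomainCond p e j s) :
    ∀ᶠ n in Filter.atTop, domainCut p e n j s = 0 := by
  by_cases hj : j < p
  · have hs : ¬ |s| ≤ e j := fun hs => h ⟨fun _ => hs, fun h' => absurd h' hj.asymm⟩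
    have : 1 - s / e j < 0 ∨ 1 + s / e j < 0 := by
      rcases lt_abs.1 (not_le.1 hs) with h1 | h1
      · left; linarith [(one_lt_div (he j)).2 h1]
      · right
        have := (one_lt_div (he j)).2 h1
        rw [neg_div] at this
        linarith
    rcases this with h1 | h1
    · filter_upwards [eventually_mul_add_nonpos h1] with n hn
      rw [domainCut, if_pos hj, Real.smoothTransition.zero_of_nonpos, zero_mul]
      refine le_trans (le_of_eq ?_) hn
      ring
    · filter_upwards [eventually_mul_add_nonpos h1] with n hn
      rw [domainCut, if_pos hj, mul_comm, Real.smoothTransition.zero_of_nonpos, zero_mul]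
      refine le_trans (le_of_eq ?_) hn
      ring
  · have hs : p < j ∧ s < 0 := by
      by_contra h'
      push Not at h'
      exact h ⟨fun h1 => absurd h1 hj, h'⟩
    filter_upwards [eventually_mul_add_nonpos hs.2] with n hn
    rw [domainCut, if_neg hj, if_pos hs.1, Real.smoothTransition.zero_of_nonpos hn]

theorem tendsto_prod_domainCut {p : Fin M₀} {e : Fin M₀ → ℝ} (he : ∀ j, 0 < e j)
    (y : Fin M₀ → ℝ) : Filter.Tendsto (fun n => ∏ j, domainCut p e n j (y j)) Filter.atTop
      (nhds ({y | ∀ j, DomainCond p e j (y j)}.indicator 1 y)) := by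
  by_cases h : ∀ j, DomainCond p e j (y j)
  · rw [Set.indicator_of_mem (by exact h)]
    simp only [domainCut_of_cond he _ (h _), Finset.prod_const_one, Pi.one_apply]
    exact tendsto_const_nhds
  · rw [Set.indicator_of_notMem (by exact h)]
    push Not at h
    obtain ⟨j, hj⟩ := h
    refine tendsto_const_nhds.congr' ?_
    filter_upwards [eventually_domainCut_eq_zero he hj] with n hn
    exact (Finset.prod_eq_zero (Finset.mem_univ j) hn).symm

namespace TreeSystem
variable {K N : ℕ} {x₀ : Fin d → ℝ} {R : ℝ} {U : Set (Fin d → ℝ)}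
  {π : Fin M₀ → (Fin d → ℝ) → ℝ}

theorem isAmplitude_domainCut (hS : TreeSystem K N x₀ R U π) {p : Fin M₀} {e : Fin M₀ → ℝ}
    (he : ∀ j, 0 < e j) (n : ℕ) (j : Fin M₀) :
    IsAmplitude K x₀ R U π (2 * (N * cutoffVariation)) fun x => domainCut p e n j (π j x) := by
  have hN := mul_cutoffVariation_nonneg N
  have key : ∀ {α : ℝ} (_ : α ≠ 0) (β : ℝ), IsAmplitude K x₀ R U π (N * cutoffVariation)
      fun x => Real.smoothTransition (α * π j x + β) := fun hα β =>
    hS.isAmplitude_comp (isCutoff_smoothTransition.comp_affine hα β)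
      (T := .leaf j) (Nat.zero_le K)
  have hn : (n + 1 : ℝ) ≠ 0 := by positivity
  have hne : (n + 1 : ℝ) / e j ≠ 0 := div_ne_zero hn (he j).ne'
  unfold domainCut
  split_ifs with h1 h2
  · rw [two_mul]
    exact hS.isAmplitude_mul (key (neg_ne_zero.2 hne) _) (key hne _)
  · exact (key hn 1).mono (by linarith)
  · exact IsAmplitude.one.mono (by linarith)

theorem isAmplitude_prod_domainCut (hS : TreeSystem K N x₀ R U π) {p : Fin M₀}
    {e : Fin M₀ → ℝ} (he : ∀ j, 0 < e j) (n : ℕ) :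
    IsAmplitude K x₀ R U π (M₀ * (2 * (N * cutoffVariation)))
      fun x => ∏ j, domainCut p e n j (π j x) := by
  simpa using hS.isAmplitude_mul_prod Finset.univ IsAmplitude.one
    fun j _ => hS.isAmplitude_domainCut (p := p) he n j

theorem isClosed_domain (hS : TreeSystem K N x₀ R U π) (p : Fin M₀) (e : Fin M₀ → ℝ) :
    IsClosed ({x | sqDist x₀ x ≤ R ^ 2} ∩ {x | ∀ j, DomainCond p e j (π j x)}) := by
  have : {x | sqDist x₀ x ≤ R ^ 2} ∩ {x | ∀ j, DomainCond p e j (π j x)} =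
      {x | sqDist x₀ x ≤ R ^ 2} ∩
        (fun x j => π j x) ⁻¹' {y | ∀ j, DomainCond p e j (y j)} := rfl
  rw [this]
  refine ContinuousOn.preimage_isClosed_of_isClosed
    (continuousOn_pi.2 fun j => hS.continuousOn_deriv (.leaf j))
    (isCompact_sqDist_le x₀ R).isClosed ?_
  simp only [DomainCond, Set.ofPred_forall, Set.ofPred_and]
  refine isClosed_iInter fun j => IsClosed.inter ?_ ?_
  · exact isClosed_iInter fun _ => isClosed_le (continuous_apply j).abs continuous_const
  · exact isClosed_iInter fun _ => isClosed_le continuous_const (continuous_apply j)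

theorem isCompact_domain (hS : TreeSystem K N x₀ R U π) (p : Fin M₀) (e : Fin M₀ → ℝ) :
    IsCompact ({x | sqDist x₀ x ≤ R ^ 2} ∩ {x | ∀ j, DomainCond p e j (π j x)}) :=
  (isCompact_sqDist_le x₀ R).of_isClosed_subset (hS.isClosed_domain p e) Set.inter_subset_left

theorem abs_setIntegral_domain_le (hS : TreeSystem K N x₀ R U π) (hd : 0 < d) {p : Fin M₀}
    {e : Fin M₀ → ℝ} (he : ∀ j, 0 < e j) {t : ℝ} (ht : 0 < t) {ψ Ψ : ℝ → ℝ}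
    (hΨ : ∀ s, HasDerivAt Ψ (ψ s) s) (hψ : Continuous ψ) (hψ1 : ∀ s, |ψ s| ≤ 1)
    (hΨ1 : ∀ s, |Ψ s| ≤ e p) {H : Fin d → DTree d M₀} (hH : (DTree.node H).depth ≤ K)
    (hlt : (DTree.node H).leavesLT (p + 1))
    (hc : ∀ x ∈ {x | sqDist x₀ x ≤ R ^ 2} ∩ {x | ∀ j, DomainCond p e j (π j x)},
      (DTree.node H).weight t e ≤ |(DTree.node H).deriv π x|) :
    |∫ x in {x | sqDist x₀ x ≤ R ^ 2} ∩ {x | ∀ j, DomainCond p e j (π j x)}, ψ (π p x)| ≤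
      iterBound d N K (M₀ * (2 * (N * cutoffVariation))) * t := by
  set B := {x | sqDist x₀ x ≤ R ^ 2} with hB
  set w := (DTree.node H).weight t e with hw
  have hw0 : 0 < w := DTree.weight_pos ht he _
  have hBc : IsCompact B := isCompact_sqDist_le x₀ R
  have hBm : MeasurableSet B := hBc.isClosed.measurableSet
  have hcont : ContinuousOn
      (fun x => farCut ((DTree.node H).deriv π x / w) * ψ (π p x)) B :=
    (contDiff_farCut.continuous.comp_continuousOn
      ((hS.continuousOn_deriv (.node H)).div_const w)).mul
      (hψ.comp_continuousOn (hS.continuousOn_deriv (.leaf p)))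
  have hlim : Filter.Tendsto (fun n => ∫ x in B, (∏ j, domainCut p e n j (π j x)) *
      (farCut ((DTree.node H).deriv π x / w) * ψ (π p x))) Filter.atTop
      (nhds (∫ x in B, {x | ∀ j, DomainCond p e j (π j x)}.indicator (fun x => ψ (π p x)) x)) := by
    refine tendsto_integral_of_dominated_convergence (fun _ => 1) (fun n => ?_) ?_ (fun n => ?_) ?_
    · exact ((((hS.isAmplitude_prod_domainCut (p := p) he n).contDiffOn.continuousOn.mono
        hS.subset).mul hcont).aestronglyMeasurable hBm)
    · exact integrableOn_const hBc.measure_lt_top.ne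
    · refine Filter.Eventually.of_forall fun x => ?_
      rw [Real.norm_eq_abs, abs_mul, abs_mul]
      refine mul_le_one₀ ((hS.isAmplitude_prod_domainCut (p := p) he n).abs_le_one x)
        (by positivity) (mul_le_one₀ ?_ (abs_nonneg _) (hψ1 _))
      exact isCutoff_farCut.abs_le_one _
    · refine (ae_restrict_iff' hBm).2 (Filter.Eventually.of_forall fun x hx => ?_)
      have := (tendsto_prod_domainCut (p := p) he fun j => π j x).mul_const
        (farCut ((DTree.node H).deriv π x / w) * ψ (π p x))
      convert this using 2
      by_cases hxD : ∀ j, DomainCond p e j (π j x)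
      · rw [Set.indicator_of_mem (by exact hxD), Set.indicator_of_mem (by exact hxD),
          farCut_of_one_le]
        · simp
        · rw [abs_div, abs_of_pos hw0]
          exact (one_le_div hw0).2 (hc x ⟨hx, hxD⟩)
      · rw [Set.indicator_of_notMem (by exact hxD), Set.indicator_of_notMem (by exact hxD),
          zero_mul]
  have hind : ∫ x in B, {x | ∀ j, DomainCond p e j (π j x)}.indicator (fun x => ψ (π p x)) x =
      ∫ x in B ∩ {x | ∀ j, DomainCond p e j (π j x)}, ψ (π p x) := by
    rw [← integral_indicator hBm, Set.indicator_indicator,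
      integral_indicator (hS.isClosed_domain p e).measurableSet]
  rw [hind] at hlim
  refine le_of_tendsto hlim.abs (Filter.Eventually.of_forall fun n => ?_)
  refine hS.abs_integral_farCut_weight_le hd ht he hΨ hψ hψ1 hΨ1 le_rfl hH hlt
    (hS.isAmplitude_prod_domainCut (p := p) he n) fun x hx j hj => ?_
  exact abs_le_of_domainCut_ne_zero he hj
    (Finset.prod_ne_zero_iff.1 hx j (Finset.mem_univ j))

theorem norm_setIntegral_exp_le (hS : TreeSystem K N x₀ R U π) (hd : 0 < d) {p : Fin M₀}
    {e : Fin M₀ → ℝ} (he : ∀ j, 0 < e j) {t : ℝ} (ht : 0 < t) {lam : ℝ} (hlam : lam ≠ 0)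
    (hep : e p = |lam|⁻¹) {H : Fin d → DTree d M₀} (hH : (DTree.node H).depth ≤ K)
    (hlt : (DTree.node H).leavesLT (p + 1))
    (hc : ∀ x ∈ {x | sqDist x₀ x ≤ R ^ 2} ∩ {x | ∀ j, DomainCond p e j (π j x)},
      (DTree.node H).weight t e ≤ |(DTree.node H).deriv π x|) :
    ‖∫ x in {x | sqDist x₀ x ≤ R ^ 2} ∩ {x | ∀ j, DomainCond p e j (π j x)},
      Complex.exp (Complex.I * lam * π p x)‖ ≤
      2 * iterBound d N K (M₀ * (2 * (N * cutoffVariation))) * t := by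
  have hlin : ∀ s : ℝ, HasDerivAt (fun s => lam * s) lam s := fun s => by
    simpa using (hasDerivAt_id s).const_mul lam
  have hbd : ∀ u : ℝ, |u| ≤ 1 → |u / lam| ≤ e p := fun u hu => by
    rw [hep, abs_div, div_eq_mul_inv]
    exact mul_le_of_le_one_left (by positivity) hu
  have hcos := hS.abs_setIntegral_domain_le hd he ht (ψ := fun s => Real.cos (lam * s))
    (Ψ := fun s => Real.sin (lam * s) / lam)
    (fun s => by
      have := ((hlin s).sin).div_const lam
      rwa [mul_div_cancel_right₀ _ hlam] at this)
    (by fun_prop) (fun s => Real.abs_cos_le_one _) (fun s => hbd _ (Real.abs_sin_le_one _))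
    hH hlt hc
  have hsin := hS.abs_setIntegral_domain_le hd he ht (ψ := fun s => Real.sin (lam * s))
    (Ψ := fun s => -Real.cos (lam * s) / lam)
    (fun s => by
      have := ((hlin s).cos.neg).div_const lam
      rwa [neg_mul, neg_neg, mul_div_cancel_right₀ _ hlam] at this)
    (by fun_prop) (fun s => Real.abs_sin_le_one _)
    (fun s => hbd _ (by rw [abs_neg]; exact Real.abs_cos_le_one _)) hH hlt hc
  have hfint : IntegrableOn (fun x => Complex.exp (Complex.I * lam * π p x))
      ({x | sqDist x₀ x ≤ R ^ 2} ∩ {x | ∀ j, DomainCond p e j (π j x)}) := by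
    refine ContinuousOn.integrableOn_compact (hS.isCompact_domain p e) ?_
    have hp : ContinuousOn (π p)
        ({x | sqDist x₀ x ≤ R ^ 2} ∩ {x | ∀ j, DomainCond p e j (π j x)}) :=
      (hS.continuousOn_deriv (.leaf p)).mono Set.inter_subset_left
    exact (by fun_prop : Continuous fun s : ℝ =>
      Complex.exp (Complex.I * lam * s)).comp_continuousOn hp
  have hexp : ∀ x, Complex.exp (Complex.I * lam * π p x) =
      Complex.exp ((lam * π p x : ℝ) * Complex.I) := fun x => by
    push_cast; congr 1; ring
  refine (Complex.norm_le_abs_re_add_abs_im _).trans ?_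
  have hre := integral_re hfint
  have him := integral_im hfint
  simp only [hexp, RCLike.re_eq_complex_re, RCLike.im_eq_complex_im,
    Complex.exp_ofReal_mul_I_re, Complex.exp_ofReal_mul_I_im] at hre him ⊢
  rw [← hre, ← him]
  linarith

end TreeSystem

theorem DTree.mult_eq_zero_of_leavesLT {m : ℕ} {T : DTree d M₀} (h : T.leavesLT m)
    {j : Fin M₀} (hj : m ≤ j) : T.mult j = 0 := by
  induction T with
  | leaf i =>
    have hi : (i : ℕ) < m := h
    exact if_neg fun hij => by subst hij; omega
  | node H ih => exact Finset.sum_eq_zero fun k _ => ih k (h k)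

theorem DTree.weight_eq {p : Fin M₀} {G : DTree d M₀} (hG : G.count ≠ 0)
    (hlt : G.leavesLT (p + 1)) {e : Fin M₀ → ℝ} (he : ∀ j, 0 < e j) {c : ℝ} (hc : 0 < c) :
    G.weight (c ^ (-(1 : ℝ) / G.count) * ∏ j ∈ Finset.univ.filter (· ≤ p),
      e j ^ ((G.mult j : ℝ) / G.count)) e = c := by
  have hn : (G.count : ℝ) ≠ 0 := Nat.cast_ne_zero.2 hG
  have hroot : ∀ {b : ℝ} (_ : 0 < b) (r : ℝ), (b ^ (r / G.count)) ^ G.count = b ^ r := by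
    intro b hb r
    rw [← Real.rpow_mul_natCast hb.le, div_mul_cancel₀ _ hn]
  have hprod : ∏ j ∈ Finset.univ.filter (· ≤ p), e j ^ G.mult j = ∏ j, e j ^ G.mult j := by
    refine Finset.prod_subset (Finset.filter_subset _ _) fun j _ hj => ?_
    have hj' : p < j := by simpa using hj
    rw [DTree.mult_eq_zero_of_leavesLT hlt (Nat.succ_le_of_lt hj'), pow_zero]
  have hpos : 0 < ∏ j, e j ^ G.mult j := Finset.prod_pos fun j _ => pow_pos (he j) _
  rw [DTree.weight, inv_pow, mul_pow, hroot hc, ← Finset.prod_pow]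
  simp only [hroot (he _), Real.rpow_natCast]
  rw [hprod, Real.rpow_neg_one, mul_inv, inv_inv, mul_assoc, inv_mul_cancel₀ hpos.ne', mul_one]

end Trees
/-- The boundary-term oscillatory integral proposition (Proposition 3 of the paper) on a
closed Euclidean ball `B` of center `x₀` and radius `R`, with boundary sphere `S`. -/
theorem oscillatory_proposition_ball
    (d M₀ K N : ℕ) (hd : 1 ≤ d) (hK : 1 ≤ K) :
    ∃ C : ℝ, ∀ x₀ : Fin d → ℝ, ∀ R : ℝ, 0 < R →
      ∀ U : Set (Fin d → ℝ), IsOpen U →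
        {x : Fin d → ℝ | ∑ i, (x i - x₀ i) ^ 2 ≤ R ^ 2} ⊆ U →
      ∀ π : Fin M₀ → (Fin d → ℝ) → ℝ, (∀ j, AnalyticOnNhd ℝ (π j) U) →
      (∀ G : DTree d M₀, G.Nontrivial → G.depth ≤ K + 1 →
        G.StrongMult {x : Fin d → ℝ | ∑ i, (x i - x₀ i) ^ 2 ≤ R ^ 2} π N ∧
        G.StrongMultSphere x₀ {x : Fin d → ℝ | ∑ i, (x i - x₀ i) ^ 2 = R ^ 2} π N) →
      ∀ m : ℕ, ∀ hm : 1 ≤ m, ∀ hmM : m ≤ M₀,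
      ∀ G : DTree d M₀, G.Nontrivial → G.depth ≤ K → G.leavesLT m →
      ∀ ε : Fin M₀ → ℝ, (∀ j, 0 < ε j) → ∀ lam : ℝ, lam ≠ 0 → ∀ c : ℝ, 0 < c →
      (∀ x ∈ {x ∈ {x : Fin d → ℝ | ∑ i, (x i - x₀ i) ^ 2 ≤ R ^ 2} |
          (∀ j : Fin M₀, (j : ℕ) + 1 < m → |π j x| ≤ ε j) ∧
          ∀ j : Fin M₀, m ≤ (j : ℕ) → 0 ≤ π j x}, c ≤ |G.deriv π x|) →
      ‖∫ x in {x ∈ {x : Fin d → ℝ | ∑ i, (x i - x₀ i) ^ 2 ≤ R ^ 2} |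
            (∀ j : Fin M₀, (j : ℕ) + 1 < m → |π j x| ≤ ε j) ∧
            ∀ j : Fin M₀, m ≤ (j : ℕ) → 0 ≤ π j x},
          Complex.exp (Complex.I * lam * π ⟨m - 1, by omega⟩ x)‖ ≤
        C * c ^ (-(1 : ℝ) / (G.count : ℝ)) *
          |lam| ^ (-(G.mult ⟨m - 1, by omega⟩ : ℝ) / (G.count : ℝ)) *
          ∏ j ∈ Finset.univ.filter (fun j : Fin M₀ => (j : ℕ) + 1 < m),
            ε j ^ ((G.mult j : ℝ) / (G.count : ℝ)) := by
  refine ⟨2 * iterBound d N K (M₀ * (2 * (N * cutoffVariation))), ?_⟩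
  intro x₀ R hR U hU hBU π hπ h m hm hmM G hG hGK hlt ε hε lam hlam c hc hGc
  have hS : TreeSystem K N x₀ R U π := TreeSystem.mk_of_strongMult hR hU hBU hπ h
  obtain ⟨p, hp⟩ : ∃ p : Fin M₀, p = ⟨m - 1, by omega⟩ := ⟨_, rfl⟩
  have hpm : (p : ℕ) + 1 = m := by rw [hp]; simp only []; omega
  rw [← hp]
  cases G with
  | leaf i => exact absurd rfl (hG i)
  | node H =>
    set e : Fin M₀ → ℝ := fun j => if j = p then |lam|⁻¹ else ε j with he_def
    have hlam' : 0 < |lam| := abs_pos.2 hlam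
    have he : ∀ j, 0 < e j := fun j => by
      simp only [he_def]; split_ifs
      · exact inv_pos.2 hlam'
      · exact hε j
    have hep : e p = |lam|⁻¹ := if_pos rfl
    have hej : ∀ j : Fin M₀, (j : ℕ) + 1 < m → e j = ε j := fun j hj =>
      if_neg fun h => by rw [h] at hj; omega
    have hcond : ∀ x : Fin d → ℝ, (∀ j, DomainCond p e j (π j x)) ↔
        (∀ j : Fin M₀, (j : ℕ) + 1 < m → |π j x| ≤ ε j) ∧
          ∀ j : Fin M₀, m ≤ (j : ℕ) → 0 ≤ π j x := fun x => by
      rw [← forall_and]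
      refine forall_congr' fun j => and_congr ?_ ?_
      · constructor
        · intro h1 hj
          rw [← hej j hj]
          exact h1 (Fin.lt_def.2 (by omega))
        · intro h1 hj
          have hj' : (j : ℕ) + 1 < m := by have := Fin.lt_def.1 hj; omega
          rw [hej j hj']
          exact h1 hj'
      · exact imp_congr_left (by rw [Fin.lt_def]; omega)
    have hset : {x ∈ {x : Fin d → ℝ | ∑ i, (x i - x₀ i) ^ 2 ≤ R ^ 2} |
          (∀ j : Fin M₀, (j : ℕ) + 1 < m → |π j x| ≤ ε j) ∧
          ∀ j : Fin M₀, m ≤ (j : ℕ) → 0 ≤ π j x} =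
        {x | sqDist x₀ x ≤ R ^ 2} ∩ {x | ∀ j, DomainCond p e j (π j x)} := by
      ext x
      exact and_congr_right fun _ => (hcond x).symm
    rw [hset] at hGc ⊢
    have hcount : (DTree.node H).count ≠ 0 := Nat.succ_ne_zero _
    have hlt' : (DTree.node H).leavesLT (p + 1) := hpm ▸ hlt
    have hweight := DTree.weight_eq hcount hlt' he hc
    set t := c ^ (-(1 : ℝ) / (DTree.node H).count) * ∏ j ∈ Finset.univ.filter (· ≤ p),
      e j ^ (((DTree.node H).mult j : ℝ) / (DTree.node H).count) with ht_def
    have ht : 0 < t := mul_pos (Real.rpow_pos_of_pos hc _)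
      (Finset.prod_pos fun j _ => Real.rpow_pos_of_pos (he j) _)
    refine (hS.norm_setIntegral_exp_le hd he ht hlam hep hGK hlt'
      (by rw [hweight]; exact hGc)).trans (le_of_eq ?_)
    have hfilter : (Finset.univ.filter (· ≤ p) : Finset (Fin M₀)) =
        insert p (Finset.univ.filter fun j : Fin M₀ => (j : ℕ) + 1 < m) := by
      ext j
      simp only [Finset.mem_filter, Finset.mem_univ, true_and, Finset.mem_insert, Fin.le_def,
        Fin.ext_iff]
      omega
    rw [ht_def, hfilter, Finset.prod_insert (by simp [hpm]), hep,
      Real.inv_rpow hlam'.le, ← Real.rpow_neg hlam'.le, neg_div' _ _,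
      Finset.prod_congr rfl fun j hj => by rw [hej j (Finset.mem_filter.1 hj).2]]
    ring
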